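/- arXiv:1402.6644 — 2 statements merged into one kernel-verified Lean document; each statement's English description precedes it below -/
import Mathlib

section
/- For every nonnegative integer n and every k with 0 ≤ k ≤ 4, the number of partitions of 5n+4 whose crank is congruent to k modulo 5 equals p(5n+4)/5; that is, M(k,5,5n+4) = p(5n+4)/5. -/
/-- The *crank* of a partition `π`: if `μ(π)` (the number of ones in `π`) is zero, it is
`λ(π)`, the largest part of `π`; otherwise it is `ν(π) - μ(π)`, where `ν(π)` is the number
of parts of `π` larger than `μ(π)`. -/
def partitionCrank {n : ℕ} (p : Nat.Partition n) : ℤ :=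
  if p.parts.count 1 = 0 then (p.parts.sup : ℤ)
  else (Multiset.card (p.parts.filter (fun x => p.parts.count 1 < x)) : ℤ)
    - (p.parts.count 1 : ℤ)

namespace CrankModFive

open PowerSeries Finset

section QSeries

variable {K : Type*} [Field K]

/-- The finite `q`-Pochhammer symbol `(a; q)_n` with `q = X`. -/
noncomputable def qPoch (a : K⟦X⟧) (n : ℕ) : K⟦X⟧ := ∏ i ∈ range n, (1 - a * X ^ i)

@[simp]
lemma qPoch_zero (a : K⟦X⟧) : qPoch a 0 = 1 := by simp [qPoch]

lemma qPoch_succ (a : K⟦X⟧) (n : ℕ) : qPoch a (n + 1) = qPoch a n * (1 - a * X ^ n) :=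
  prod_range_succ _ _

lemma qPoch_succ' (a : K⟦X⟧) (n : ℕ) : qPoch a (n + 1) = (1 - a) * qPoch (a * X) n := by
  simp only [qPoch, prod_range_succ', pow_zero, mul_one]
  rw [mul_comm]
  congr 1
  exact prod_congr rfl fun i _ ↦ by ring

lemma constantCoeff_qPoch_mul_X (a : K⟦X⟧) (n : ℕ) :
    constantCoeff (qPoch (a * X) n) = 1 := by
  simp [qPoch, map_prod]

lemma constantCoeff_qPoch_X (n : ℕ) : constantCoeff (qPoch (X : K⟦X⟧) n) = 1 := by
  simpa using constantCoeff_qPoch_mul_X (1 : K⟦X⟧) n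

lemma qPoch_X_ne_zero (n : ℕ) : constantCoeff (qPoch (X : K⟦X⟧) n) ≠ 0 := by
  simp [constantCoeff_qPoch_X]

lemma qPoch_X_mul_inv (n : ℕ) : qPoch (X : K⟦X⟧) n * (qPoch X n)⁻¹ = 1 :=
  PowerSeries.mul_inv_cancel _ (qPoch_X_ne_zero n)

lemma qPoch_X_succ (n : ℕ) : qPoch (X : K⟦X⟧) (n + 1) = qPoch X n * (1 - X ^ (n + 1)) := by
  rw [qPoch_succ, pow_succ']

lemma inv_qPoch_X (n : ℕ) :
    (qPoch (X : K⟦X⟧) n)⁻¹ = (1 - X ^ (n + 1)) * (qPoch X (n + 1))⁻¹ := by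
  have h₁ := qPoch_X_mul_inv (K := K) n
  have h₂ := qPoch_X_mul_inv (K := K) (n + 1)
  rw [qPoch_X_succ] at h₂ ⊢
  linear_combination (1 - X ^ (n + 1)) * (qPoch X n * (1 - X ^ (n + 1)))⁻¹ * h₁
    - (qPoch (X : K⟦X⟧) n)⁻¹ * h₂

lemma X_pow_dvd_qPoch_sub {k M : ℕ} (h : k ≤ M) :
    (X : K⟦X⟧) ^ (k + 1) ∣ qPoch X M - qPoch X k := by
  induction M, h using Nat.le_induction with
  | base => simp
  | succ M h ih =>
    rw [qPoch_X_succ, show qPoch X M * (1 - X ^ (M + 1)) - qPoch X k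
      = (qPoch X M - qPoch X k) - X ^ (M + 1) * qPoch (X : K⟦X⟧) M by ring]
    exact dvd_sub ih ((pow_dvd_pow _ (by lia)).mul_right _)

/-- One step of the functional equation behind the `q`-binomial theorem, truncated at `M`. -/
lemma qBinomial_step (a u : K⟦X⟧) (M : ℕ) :
    (∑ j ∈ range (M + 1), qPoch a j * (qPoch X j)⁻¹ * u ^ j) * (1 - u) =
      (1 - a * u) * (∑ j ∈ range (M + 1), qPoch a j * (qPoch X j)⁻¹ * (u * X) ^ j)
        - qPoch a M * (qPoch X M)⁻¹ * u ^ (M + 1) * (1 - a * X ^ M) := by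
  induction M with
  | zero => simp; ring
  | succ M ih =>
    rw [sum_range_succ _ (M + 1), sum_range_succ _ (M + 1), add_mul, ih, inv_qPoch_X M,
      qPoch_succ a M]
    ring

/-- The `q`-binomial theorem modulo `X ^ (M + 1)`. -/
lemma qBinomial (a v : K⟦X⟧) (M : ℕ) :
    (X : K⟦X⟧) ^ (M + 1) ∣
      (∑ j ∈ range (M + 1), qPoch a j * (qPoch X j)⁻¹ * (v * X) ^ j) * qPoch (v * X) M
        - qPoch (a * (v * X)) M := by
  have key (k : ℕ) : (X : K⟦X⟧) ^ (M + 1) ∣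
      (∑ j ∈ range (M + 1), qPoch a j * (qPoch X j)⁻¹ * (v * X) ^ j) * qPoch (v * X) k
        - qPoch (a * (v * X)) k *
          ∑ j ∈ range (M + 1), qPoch a j * (qPoch X j)⁻¹ * (v * X ^ (k + 1)) ^ j := by
    induction k with
    | zero => simp
    | succ k ih =>
      obtain ⟨c, hc⟩ := ih
      have h := qBinomial_step a (v * X ^ (k + 1)) M
      rw [show v * X ^ (k + 1) * X = v * X ^ (k + 1 + 1) by ring] at h
      rw [qPoch_succ, qPoch_succ]
      generalize (∑ j ∈ range (M + 1), qPoch a j * (qPoch X j)⁻¹ * (v * X) ^ j) = S at *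
      generalize (∑ j ∈ range (M + 1), qPoch a j * (qPoch X j)⁻¹ * (v * X ^ (k + 1)) ^ j) = T at *
      generalize (∑ j ∈ range (M + 1), qPoch a j * (qPoch X j)⁻¹ * (v * X ^ (k + 1 + 1)) ^ j) = U
        at *
      refine ⟨c * (1 - v * X * X ^ k) - qPoch (a * (v * X)) k * (qPoch a M * (qPoch X M)⁻¹ *
        v ^ (M + 1) * X ^ (k * (M + 1)) * (1 - a * X ^ M)), ?_⟩
      have e : (v * X ^ (k + 1)) ^ (M + 1) = v ^ (M + 1) * X ^ (k * (M + 1)) * X ^ (M + 1) := by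
        ring
      rw [e] at h
      linear_combination (1 - v * X * X ^ k) * hc + qPoch (a * (v * X)) k * h
  have h₁ : (X : K⟦X⟧) ^ (M + 1) ∣
      (∑ j ∈ range (M + 1), qPoch a j * (qPoch X j)⁻¹ * (v * X ^ (M + 1)) ^ j) - 1 := by
    rw [sum_range_succ']
    have : qPoch a 0 * (qPoch (X : K⟦X⟧) 0)⁻¹ * (v * X ^ (M + 1)) ^ 0 = 1 := by simp
    rw [this, add_sub_cancel_right]
    exact dvd_sum fun j _ ↦ ((dvd_mul_left _ v).trans (dvd_pow_self _ (by simp))).mul_left _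
  obtain ⟨c, hc⟩ := key M
  obtain ⟨d, hd⟩ := h₁
  exact ⟨c + qPoch (a * (v * X)) M * d, by
    linear_combination hc + qPoch (a * (v * X)) M * hd⟩

/-- Reciprocals of `(q; q)_k`, with the index shifted by one so that the value at `-1` is `0`. -/
noncomputable def qInv (K : Type*) [Field K] : ℕ → K⟦X⟧
  | 0 => 0
  | k + 1 => (qPoch X k)⁻¹

lemma qInv_eq (k : ℕ) : qInv K k = (1 - X ^ k) * qInv K (k + 1) := by
  cases k with
  | zero => simp [qInv]
  | succ k => exact inv_qPoch_X k

/-- The Gaussian binomial coefficient `[2n + 1, n - j]`, vanishing for `n < j`. -/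
noncomputable def qCentral (K : Type*) [Field K] (n j : ℕ) : K⟦X⟧ :=
  qPoch X (2 * n + 1) * (qInv K (n + 1 - j) * qInv K (n + j + 2))

lemma qCentral_eq_zero {n j : ℕ} (h : n < j) : qCentral K n j = 0 := by
  simp [qCentral, show n + 1 - j = 0 by lia, qInv]

lemma qCentral_succ_zero (n : ℕ) :
    qCentral K (n + 1) 0 = (1 + X ^ (2 * n + 2) + X ^ (n + 1)) * qCentral K n 0
      + X ^ (n + 2) * qCentral K n 1 := by
  have h₁ := qInv_eq (K := K) n
  have h₂ := qInv_eq (K := K) (n + 1)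
  have h₃ := qInv_eq (K := K) (n + 2)
  simp only [qCentral, Nat.sub_zero, Nat.add_sub_cancel, add_zero,
    show 2 * (n + 1) + 1 = 2 * n + 1 + 1 + 1 by ring, qPoch_X_succ, add_assoc, Nat.reduceAdd]
  simp only [add_assoc, Nat.reduceAdd] at h₁ h₂ h₃
  rw [h₁, h₂, h₃]
  ring

lemma qCentral_succ_succ {n j : ℕ} (h : j ≤ n) :
    qCentral K (n + 1) (j + 1) = (1 + X ^ (2 * n + 2)) * qCentral K n (j + 1)
      + X ^ (n - j) * qCentral K n j + X ^ (n + j + 3) * qCentral K n (j + 2) := by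
  obtain ⟨m, rfl⟩ := Nat.exists_eq_add_of_le h
  rcases m with _ | m
  · have h₁ := qInv_eq (K := K) (2 * j + 2)
    have h₂ := qInv_eq (K := K) (2 * j + 3)
    have h₃ : qInv K 1 = 1 := by simp [qInv]
    rw [qCentral_eq_zero (show j + 0 < j + 1 by lia), qCentral_eq_zero (show j + 0 < j + 2 by lia)]
    simp only [qCentral, add_zero, Nat.sub_self, pow_zero, show j + 1 - j = 1 by lia,
      show j + 1 + 1 - (j + 1) = 1 by lia, show j + 1 + (j + 1) + 2 = 2 * j + 3 + 1 by lia,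
      show j + j + 2 = 2 * j + 2 by lia, show 2 * (j + 1) + 1 = 2 * j + 1 + 1 + 1 by ring,
      qPoch_X_succ, h₁, h₂, h₃]
    ring
  · have h₁ := qInv_eq (K := K) (m + 1)
    have h₂ := qInv_eq (K := K) m
    have h₃ := qInv_eq (K := K) (2 * j + m + 3)
    have h₄ := qInv_eq (K := K) (2 * j + m + 4)
    simp only [qCentral, show j + (m + 1) + 1 + 1 - (j + 1) = m + 1 + 1 by lia,
      show j + (m + 1) + 1 - (j + 1) = m + 1 by lia, show j + (m + 1) + 1 - j = m + 1 + 1 by lia,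
      show j + (m + 1) + 1 - (j + 2) = m by lia,
      show j + (m + 1) + 1 + (j + 1) + 2 = 2 * j + m + 4 + 1 by lia,
      show j + (m + 1) + (j + 1) + 2 = 2 * j + m + 3 + 1 by lia,
      show j + (m + 1) + j + 2 = 2 * j + m + 3 by lia,
      show j + (m + 1) + (j + 2) + 2 = 2 * j + m + 4 + 1 by lia,
      show j + (m + 1) - j = m + 1 by lia,
      show 2 * (j + (m + 1) + 1) + 1 = 2 * (j + (m + 1)) + 1 + 1 + 1 by ring, qPoch_X_succ]
    rw [h₃, h₄, h₂, h₁]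
    ring

/-- The Laurent polynomial `∑_{-j ≤ i ≤ j} w ^ i`, in closed form. -/
def laurentSum (w : K) (j : ℕ) : K := (w ^ (j + 1) - w⁻¹ ^ j) / (w - 1)

lemma laurentSum_zero {w : K} (h₁ : w ≠ 1) : laurentSum w 0 = 1 := by
  simp [laurentSum, div_self (sub_ne_zero.2 h₁)]

lemma add_inv_mul_laurentSum_zero {w : K} (h₀ : w ≠ 0) (h₁ : w ≠ 1) :
    (w + w⁻¹) * laurentSum w 0 = laurentSum w 1 - laurentSum w 0 := by
  have := sub_ne_zero.2 h₁
  simp only [laurentSum]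
  field_simp
  ring

lemma add_inv_mul_laurentSum_succ {w : K} (h₀ : w ≠ 0) (j : ℕ) :
    (w + w⁻¹) * laurentSum w (j + 1) = laurentSum w (j + 2) + laurentSum w j := by
  have h := mul_inv_cancel₀ h₀
  rw [laurentSum, laurentSum, laurentSum, ← mul_div_assoc, ← add_div]
  congr 1
  linear_combination (w ^ (j + 1) - w⁻¹ ^ j) * h

/-- A finite form of the Jacobi triple product, divided by `1 - w⁻¹`. -/
lemma qPoch_mul_qPoch_inv {w : K} (h₀ : w ≠ 0) (h₁ : w ≠ 1) (n : ℕ) :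
    qPoch (C w * X) n * qPoch (C w⁻¹ * X) n =
      ∑ j ∈ range (n + 1),
        (-1) ^ j * X ^ (j * (j + 1) / 2) * C (laurentSum w j) * qCentral K n j := by
  induction n with
  | zero =>
    have := qPoch_X_mul_inv (K := K) 1
    simpa [laurentSum_zero h₁, qCentral, qInv] using this.symm
  | succ n ih =>
    have htri (j : ℕ) : (j + 1) * (j + 1 + 1) / 2 = j * (j + 1) / 2 + (j + 1) := by
      rw [show (j + 1) * (j + 1 + 1) = j * (j + 1) + (j + 1) * 2 by ring,
        Nat.add_mul_div_right _ _ two_pos]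
    set t : ℕ → K⟦X⟧ := fun j ↦ (-1) ^ j * X ^ (j * (j + 1) / 2) with ht
    have ht₁ (j : ℕ) : t (j + 1) = -X ^ (j + 1) * t j := by
      simp only [ht, htri]; ring
    set s : ℕ → K⟦X⟧ := fun j ↦ C (laurentSum w j)
    have hs₀ : (C w + C w⁻¹) * s 0 = s 1 - s 0 := by
      simp only [s, ← map_add, ← map_mul, ← map_sub, add_inv_mul_laurentSum_zero h₀ h₁]
    have hs₁ (j : ℕ) : (C w + C w⁻¹) * s (j + 1) = s (j + 2) + s j := by
      simp only [s, ← map_add, ← map_mul, add_inv_mul_laurentSum_succ h₀]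
    have hw : (C w * C w⁻¹ : K⟦X⟧) = 1 := by rw [← map_mul, mul_inv_cancel₀ h₀, map_one]
    change _ = ∑ j ∈ range (n + 1), t j * s j * qCentral K n j at ih
    change _ = ∑ j ∈ range (n + 1 + 1), t j * s j * qCentral K (n + 1) j
    have hstep : qPoch (C w * X) (n + 1) * qPoch (C w⁻¹ * X) (n + 1) =
        (qPoch (C w * X) n * qPoch (C w⁻¹ * X) n) *
          (1 + X ^ (2 * n + 2) - (C w + C w⁻¹) * X ^ (n + 1)) := by
      rw [qPoch_succ, qPoch_succ]
      linear_combination (qPoch (C w * X) n * qPoch (C w⁻¹ * X) n) * X ^ (2 * n + 2) * hw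
    have hvan₁ : qCentral K n (n + 1) = 0 := qCentral_eq_zero (by lia)
    have hvan₂ : qCentral K n (n + 2) = 0 := qCentral_eq_zero (by lia)
    -- multiplication by `w + w⁻¹`, by summation by parts
    have hshift : (∑ j ∈ range (n + 1), t j * s j * qCentral K n j) * (C w + C w⁻¹) =
        t 1 * s 0 * qCentral K n 1 - t 0 * s 0 * qCentral K n 0 +
        ∑ j ∈ range (n + 1), s (j + 1) *
          (t j * qCentral K n j + t (j + 2) * qCentral K n (j + 2)) := by
      have e₁ : ∑ j ∈ range (n + 1), s (j + 1) * (t (j + 2) * qCentral K n (j + 2)) =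
          ∑ j ∈ range n, s (j + 1) * (t (j + 2) * qCentral K n (j + 2)) := by
        rw [sum_range_succ, hvan₂]; simp
      have e₂ : ∑ j ∈ range (n + 1), t j * s (j + 1) * qCentral K n j =
          t 0 * s 1 * qCentral K n 0 +
            ∑ j ∈ range n, t (j + 1) * s (j + 2) * qCentral K n (j + 1) := by
        rw [sum_range_succ', add_comm]
      have e₃ : ∑ j ∈ range n, s j * (t (j + 1) * qCentral K n (j + 1)) =
          t 1 * s 0 * qCentral K n 1 +
            ∑ j ∈ range n, s (j + 1) * (t (j + 2) * qCentral K n (j + 2)) := by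
        have := sum_range_succ (fun j ↦ s j * (t (j + 1) * qCentral K n (j + 1))) n
        rw [hvan₁, mul_zero, mul_zero, add_zero] at this
        rw [← this, sum_range_succ', add_comm]
        ring
      have e₄ : (∑ j ∈ range n, t (j + 1) * s (j + 1) * qCentral K n (j + 1)) * (C w + C w⁻¹) =
          ∑ j ∈ range n, t (j + 1) * s (j + 2) * qCentral K n (j + 1) +
            ∑ j ∈ range n, s j * (t (j + 1) * qCentral K n (j + 1)) := by
        rw [← sum_add_distrib, sum_mul]
        exact sum_congr rfl fun j _ ↦ by
          linear_combination t (j + 1) * qCentral K n (j + 1) * hs₁ j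
      have e₅ : ∑ j ∈ range (n + 1), s (j + 1) *
            (t j * qCentral K n j + t (j + 2) * qCentral K n (j + 2)) =
          ∑ j ∈ range (n + 1), t j * s (j + 1) * qCentral K n j +
            ∑ j ∈ range (n + 1), s (j + 1) * (t (j + 2) * qCentral K n (j + 2)) := by
        rw [← sum_add_distrib]
        exact sum_congr rfl fun j _ ↦ by ring
      rw [e₅, e₁, e₂, sum_range_succ', add_mul, e₄, e₃]
      linear_combination t 0 * qCentral K n 0 * hs₀
    have hterm : ∑ j ∈ range (n + 1), t (j + 1) * s (j + 1) * qCentral K (n + 1) (j + 1) =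
        (∑ j ∈ range n, t (j + 1) * s (j + 1) * qCentral K n (j + 1)) * (1 + X ^ (2 * n + 2)) -
        (∑ j ∈ range (n + 1), s (j + 1) *
          (t j * qCentral K n j + t (j + 2) * qCentral K n (j + 2))) * X ^ (n + 1) := by
      have := sum_range_succ (fun j ↦ t (j + 1) * s (j + 1) * qCentral K n (j + 1)) n
      rw [hvan₁, mul_zero, add_zero] at this
      rw [← this, sum_mul, sum_mul, ← sum_sub_distrib]
      refine sum_congr rfl fun j hj ↦ ?_
      have hj : j ≤ n := by simpa [Nat.lt_succ_iff] using hj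
      rw [qCentral_succ_succ hj, ht₁ (j + 1), ht₁ j]
      obtain ⟨m, rfl⟩ := Nat.exists_eq_add_of_le hj
      rw [show j + m - j = m by lia]
      ring
    rw [hstep, ih, mul_sub, ← mul_assoc, hshift, sum_range_succ' _ (n + 1), hterm,
      qCentral_succ_zero, sum_range_succ', ht₁ 0]
    ring

/-- The Jacobi triple product modulo `X ^ (N + 1)`. -/
lemma X_pow_dvd_triple_sub {w : K} (h₀ : w ≠ 0) (h₁ : w ≠ 1) (N : ℕ) :
    (X : K⟦X⟧) ^ (N + 1) ∣
      qPoch X N * (qPoch (C w * X) N * qPoch (C w⁻¹ * X) N) -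
      ∑ j ∈ range (N + 1), (-1) ^ j * X ^ (j * (j + 1) / 2) * C (laurentSum w j) := by
  rw [qPoch_mul_qPoch_inv h₀ h₁, mul_sum, ← sum_sub_distrib]
  refine dvd_sum fun j hj ↦ ?_
  have hj : j ≤ N := by simpa [Nat.lt_succ_iff] using hj
  have htri : j ≤ j * (j + 1) / 2 := by
    rw [Nat.le_div_iff_mul_le two_pos]
    rcases j with _ | j
    · simp
    · exact Nat.mul_le_mul_left _ (by lia)
  obtain ⟨c, hc⟩ := X_pow_dvd_qPoch_sub (K := K) (Nat.sub_le N j)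
  obtain ⟨d, hd⟩ := (pow_dvd_pow (X : K⟦X⟧) (show N - j + 1 ≤ N + j + 1 + 1 by lia)).trans
    (X_pow_dvd_qPoch_sub (K := K) (show N + j + 1 ≤ 2 * N + 1 by lia))
  have i₁ := qPoch_X_mul_inv (K := K) (N - j)
  have i₂ := qPoch_X_mul_inv (K := K) (N + j + 1)
  have hmul : (X : K⟦X⟧) ^ (N + 1) ∣ X ^ (j * (j + 1) / 2) * X ^ (N - j + 1) := by
    rw [← pow_add]
    exact pow_dvd_pow _ (by lia)
  have hcent : (X : K⟦X⟧) ^ (N - j + 1) ∣ qPoch X N * qCentral K N j - 1 := by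
    have e : qCentral K N j =
        qPoch X (2 * N + 1) * ((qPoch X (N - j))⁻¹ * (qPoch X (N + j + 1))⁻¹) := by
      rw [qCentral, show N + 1 - j = N - j + 1 by lia]
      rfl
    refine ⟨(qPoch X (N - j))⁻¹ * (qPoch X (N + j + 1))⁻¹ *
      (c * qPoch X (2 * N + 1) + qPoch X (N - j) * d), ?_⟩
    rw [e]
    linear_combination (qPoch X (N - j))⁻¹ * (qPoch X (N + j + 1))⁻¹ *
      (qPoch X (2 * N + 1) * hc + qPoch X (N - j) * hd) +
      qPoch X (N + j + 1) * (qPoch X (N + j + 1))⁻¹ * i₁ + i₂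
  refine (hmul.trans (mul_dvd_mul_left _ hcent)).trans
    ⟨(-1) ^ j * C (laurentSum w j), ?_⟩
  ring

end QSeries

section Partitions

variable {K : Type*} [Field K]

/-- The generating function of partitions, each weighted by the product of `g` over its parts. -/
noncomputable def weightedGenFun (g : ℕ → K) : K⟦X⟧ :=
  PowerSeries.mk fun n ↦ ∑ p : n.Partition, (p.parts.map g).prod

lemma sum_partition_mem (g : ℕ → K) {n a : ℕ} (ha : 1 ≤ a) (han : a ≤ n) :
    ∑ p : n.Partition with a ∈ p.parts, (p.parts.map g).prod =
      g a * (weightedGenFun g).coeff (n - a) := by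
  rw [weightedGenFun, coeff_mk, mul_sum, ← Finset.sum_subtype_eq_sum_filter, subtype_univ]
  refine Fintype.sum_equiv (Nat.Partition.partitionWithPartEquiv ha han) _ _ fun p ↦ ?_
  rw [Nat.Partition.partitionWithPartEquiv_apply_parts, ← Multiset.prod_cons,
    ← Multiset.map_cons g, Multiset.cons_erase p.2]

lemma weightedGenFun_mul_one_sub (g : ℕ → K) {a : ℕ} (ha : 1 ≤ a) :
    weightedGenFun g * (1 - C (g a) * X ^ a) = weightedGenFun (Function.update g a 0) := by
  ext n
  have h₁ : (weightedGenFun (Function.update g a 0)).coeff n =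
      ∑ p : n.Partition with a ∉ p.parts, (p.parts.map g).prod := by
    rw [weightedGenFun, coeff_mk, sum_filter]
    refine sum_congr rfl fun p _ ↦ ?_
    split_ifs with h
    · exact Multiset.prod_eq_zero (Multiset.mem_map.2 ⟨a, h, Function.update_self ..⟩)
    · refine congrArg Multiset.prod (Multiset.map_congr rfl fun x hx ↦ ?_)
      rw [Function.update_of_ne (by rintro rfl; exact h hx)]
  have h₂ : (weightedGenFun g).coeff n = ∑ p : n.Partition, (p.parts.map g).prod := by
    rw [weightedGenFun, coeff_mk]
  rw [h₁, mul_sub, mul_one, map_sub, h₂, ← mul_assoc, coeff_mul_X_pow', coeff_mul_C,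
    ← sum_filter_add_sum_filter_not univ fun p : n.Partition ↦ a ∈ p.parts]
  split_ifs with h
  · rw [sum_partition_mem g ha h]; ring
  · rw [filter_false_of_mem, sum_empty]
    · ring
    · exact fun p _ hp ↦ h (Nat.Partition.le_of_mem_parts hp)

lemma weightedGenFun_mul_prod (g : ℕ → K) {s : Finset ℕ} (hs : 0 ∉ s) :
    weightedGenFun g * ∏ i ∈ s, (1 - C (g i) * X ^ i) =
      weightedGenFun fun i ↦ if i ∈ s then 0 else g i := by
  induction s using Finset.induction_on with
  | empty => simp
  | insert a s ha ih =>
    have := weightedGenFun_mul_one_sub (fun i ↦ if i ∈ s then 0 else g i) (a := a) (by grind)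
    rw [if_neg ha] at this
    rw [prod_insert ha, mul_left_comm, ih (by grind), mul_comm, this]
    congr 1
    ext i
    by_cases h : i = a
    · subst h; simp
    · simp [h]

lemma X_pow_dvd_weightedGenFun_sub_one {g : ℕ → K} {N : ℕ}
    (h : ∀ i, 1 ≤ i → i ≤ N → g i = 0) : X ^ (N + 1) ∣ weightedGenFun g - 1 := by
  rw [X_pow_dvd_iff]
  intro m hm
  rw [map_sub, weightedGenFun, coeff_mk, coeff_one]
  split_ifs with h₀
  · subst h₀; simp
  · rw [sub_zero]
    refine sum_eq_zero fun p _ ↦ ?_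
    obtain ⟨i, hi⟩ : ∃ i, i ∈ p.parts := by
      refine Multiset.exists_mem_of_ne_zero fun h' ↦ h₀ ?_
      simpa [h'] using p.parts_sum.symm
    exact Multiset.prod_eq_zero (Multiset.mem_map.2 ⟨i, hi,
      h i (p.parts_pos hi) ((Nat.Partition.le_of_mem_parts hi).trans (by lia))⟩)

/-- The weight selecting the partitions with all parts between `2` and `m`. -/
def boundedWeight (K : Type*) [Field K] (m i : ℕ) : K := if 2 ≤ i ∧ i ≤ m then 1 else 0

/-- The weight `z ^ #{parts > j}` on partitions without ones. -/
def largeWeight (z : K) (j i : ℕ) : K := if i = 1 then 0 else if j < i then z else 1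

lemma sum_crank_no_ones (z : K) {n : ℕ} (hn : 2 ≤ n) :
    ∑ p : n.Partition with p.parts.count 1 = 0, z ^ partitionCrank p =
      ∑ m ∈ Icc 2 n, z ^ m * (weightedGenFun (boundedWeight K m)).coeff (n - m) := by
  have hsup (p : n.Partition) (h : p.parts.count 1 = 0) :
      p.parts.sup ∈ p.parts ∧ p.parts.sup ∈ Icc 2 n := by
    have hne : p.parts ≠ 0 := fun h' ↦ by
      have := p.parts_sum
      rw [h', Multiset.sum_zero] at this
      lia
    have hmem : p.parts.sup ∈ p.parts := by
      clear h
      generalize p.parts = s at hne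
      induction s using Multiset.induction_on with
      | empty => exact absurd rfl hne
      | cons a s ih =>
        rcases eq_or_ne s 0 with rfl | hs
        · simp
        · rw [Multiset.sup_cons]
          rcases max_choice a s.sup with h | h
          · rw [h]; exact Multiset.mem_cons_self _ _
          · rw [h]; exact Multiset.mem_cons_of_mem (ih hs)
    refine ⟨hmem, mem_Icc.2 ⟨?_, Nat.Partition.le_of_mem_parts hmem⟩⟩
    have h₁ := p.parts_pos hmem
    have h₂ : p.parts.sup ≠ 1 := fun e ↦ Multiset.count_eq_zero.1 h (e ▸ hmem)
    lia
  have hind (p : n.Partition) (m : ℕ) (hm : m ∈ Icc 2 n) :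
      (if m ∈ p.parts then (p.parts.map (boundedWeight K m)).prod else 0) =
        if p.parts.count 1 = 0 ∧ p.parts.sup = m then 1 else 0 := by
    by_cases hc : p.parts.count 1 = 0 ∧ p.parts.sup = m
    · obtain ⟨h, rfl⟩ := hc
      rw [if_pos (hsup p h).1, if_pos ⟨h, rfl⟩]
      refine Multiset.prod_eq_one fun x hx ↦ ?_
      obtain ⟨i, hi, rfl⟩ := Multiset.mem_map.1 hx
      refine if_pos ⟨?_, Multiset.le_sup hi⟩
      have h₁ := p.parts_pos hi
      have h₂ : i ≠ 1 := fun e ↦ Multiset.count_eq_zero.1 h (e ▸ hi)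
      lia
    · rw [if_neg hc]
      split_ifs with hmp
      · obtain ⟨i, hi, hi'⟩ : ∃ i ∈ p.parts, ¬ (2 ≤ i ∧ i ≤ m) := by
          by_contra! hall
          refine hc ⟨Multiset.count_eq_zero.2 fun h ↦ ?_, le_antisymm
            (Multiset.sup_le.2 fun i hi ↦ (hall i hi).2) (Multiset.le_sup hmp)⟩
          exact absurd (hall 1 h).1 (by lia)
        exact Multiset.prod_eq_zero (Multiset.mem_map.2 ⟨i, hi, if_neg hi'⟩)
      · rfl
  have hrhs : ∀ m ∈ Icc 2 n, z ^ m * (weightedGenFun (boundedWeight K m)).coeff (n - m) =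
      ∑ p : n.Partition, if p.parts.count 1 = 0 ∧ p.parts.sup = m then z ^ m else 0 := by
    intro m hm
    have hm' := mem_Icc.1 hm
    have h := sum_partition_mem (boundedWeight K m) (n := n) (a := m) (by lia) hm'.2
    rw [show boundedWeight K m m = 1 from if_pos ⟨hm'.1, le_rfl⟩, one_mul, sum_filter,
      sum_congr rfl fun p _ ↦ hind p m hm] at h
    rw [← h, mul_sum]
    exact sum_congr rfl fun p _ ↦ by split_ifs <;> simp
  rw [sum_congr rfl hrhs, sum_comm, sum_filter]
  refine sum_congr rfl fun p _ ↦ ?_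
  split_ifs with h
  · simp only [h, true_and]
    rw [sum_ite_eq (Icc 2 n) p.parts.sup, if_pos (hsup p h).2, partitionCrank, if_pos h,
      zpow_natCast]
  · simp [h]

lemma prod_map_largeWeight (z : K) (j : ℕ) {s : Multiset ℕ} (hs : 1 ∉ s) :
    (s.map (largeWeight z j)).prod = z ^ (s.filter (j < ·)).card := by
  induction s using Multiset.induction_on with
  | empty => simp
  | cons a s ih =>
    rw [Multiset.mem_cons, not_or] at hs
    rw [Multiset.map_cons, Multiset.prod_cons, ih hs.2, Multiset.filter_cons, largeWeight,
      if_neg (Ne.symm hs.1)]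
    split_ifs <;> simp [pow_succ']

lemma sum_crank_ones {z : K} (hz : z ≠ 0) {n j : ℕ} (hj : 1 ≤ j) (hjn : j ≤ n) :
    ∑ p : n.Partition with p.parts.count 1 = j, z ^ partitionCrank p =
      z⁻¹ ^ j * (weightedGenFun (largeWeight z j)).coeff (n - j) := by
  have h₁ : (weightedGenFun (largeWeight z j)).coeff (n - j) =
      ∑ q : (n - j).Partition with q.parts.count 1 = 0, (q.parts.map (largeWeight z j)).prod := by
    rw [weightedGenFun, coeff_mk, sum_filter]
    refine sum_congr rfl fun q _ ↦ ?_
    split_ifs with h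
    · rfl
    · exact Multiset.prod_eq_zero (Multiset.mem_map.2 ⟨1, by
        simpa [Multiset.count_eq_zero] using h, if_pos rfl⟩)
  rw [h₁, mul_sum]
  symm
  refine sum_bij (fun q _ ↦ (⟨q.parts + Multiset.replicate j 1, ?_, ?_⟩ : n.Partition))
    ?_ ?_ ?_ ?_
  · intro i hi
    rcases Multiset.mem_add.1 hi with hi | hi
    · exact q.parts_pos hi
    · rw [Multiset.eq_of_mem_replicate hi]; exact one_pos
  · simp [q.parts_sum, hjn]
  · intro q hq
    simp only [mem_filter, mem_univ, true_and] at hq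
    simp [hq]
  · intro q _ q' _ h
    have := congrArg Nat.Partition.parts h
    exact Nat.Partition.ext (add_right_cancel this)
  · intro p hp
    simp only [mem_filter, mem_univ, true_and] at hp
    have hle : Multiset.replicate j 1 ≤ p.parts := Multiset.le_count_iff_replicate_le.1 hp.ge
    have hadd := Multiset.sub_add_cancel hle
    refine ⟨⟨p.parts - Multiset.replicate j 1, fun hi ↦ p.parts_pos
      (Multiset.mem_of_le (Multiset.sub_le_self _ _) hi), ?_⟩, ?_, ?_⟩
    · have := congrArg Multiset.sum hadd
      rw [Multiset.sum_add, p.parts_sum, Multiset.sum_replicate, smul_eq_mul, mul_one] at this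
      lia
    · simp only [mem_filter, mem_univ, true_and]
      rw [Multiset.count_sub, Multiset.count_replicate_self, hp, Nat.sub_self]
    · exact Nat.Partition.ext hadd
  · intro q hq
    simp only [mem_filter, mem_univ, true_and] at hq
    have hcount : (q.parts + Multiset.replicate j 1).count 1 = j := by simp [hq]
    have hfilter : (Multiset.replicate j 1).filter (j < ·) = 0 := by
      refine Multiset.filter_eq_nil.2 fun a ha ↦ ?_
      rw [Multiset.eq_of_mem_replicate ha]; lia
    rw [prod_map_largeWeight z j (Multiset.count_eq_zero.1 hq), partitionCrank]
    simp only [hcount, if_neg (show j ≠ 0 by lia), Multiset.filter_add, hfilter, add_zero]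
    rw [zpow_sub₀ hz, zpow_natCast, zpow_natCast, inv_pow, div_eq_inv_mul]

/-- The crank polynomial of `n`, as a sum over the number of ones. -/
lemma sum_crank {z : K} (hz : z ≠ 0) {n : ℕ} (hn : 2 ≤ n) :
    ∑ p : n.Partition, z ^ partitionCrank p =
      ∑ m ∈ Icc 2 n, z ^ m * (weightedGenFun (boundedWeight K m)).coeff (n - m) +
      ∑ j ∈ Icc 1 n, z⁻¹ ^ j * (weightedGenFun (largeWeight z j)).coeff (n - j) := by
  rw [← sum_crank_no_ones z hn,
    ← sum_congr rfl fun j hj ↦ sum_crank_ones hz (mem_Icc.1 hj).1 (mem_Icc.1 hj).2,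
    ← sum_filter_add_sum_filter_not univ fun p : n.Partition ↦ p.parts.count 1 = 0]
  congr 1
  rw [← sum_fiberwise_of_maps_to (t := Icc 1 n) (g := fun p : n.Partition ↦ p.parts.count 1)]
  · refine sum_congr rfl fun j hj ↦ sum_congr ?_ fun _ _ ↦ rfl
    ext p
    have := (mem_Icc.1 hj).1
    simp only [mem_filter, mem_univ, true_and]
    lia
  · intro p hp
    simp only [mem_filter, mem_univ, true_and] at hp
    refine mem_Icc.2 ⟨Nat.pos_of_ne_zero hp, ?_⟩
    obtain ⟨t, ht⟩ := Multiset.le_iff_exists_add.1 (Multiset.le_count_iff_replicate_le.1 le_rfl :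
      Multiset.replicate (p.parts.count 1) 1 ≤ p.parts)
    have := congrArg Multiset.sum ht
    rw [Multiset.sum_add, p.parts_sum, Multiset.sum_replicate, smul_eq_mul, mul_one] at this
    lia

end Partitions

section CrankGenFun

variable {K : Type*} [Field K]

lemma weightedGenFun_eq_one {g : ℕ → K} (h : ∀ i, 1 ≤ i → g i = 0) : weightedGenFun g = 1 := by
  ext n
  have := X_pow_dvd_iff.1 (X_pow_dvd_weightedGenFun_sub_one (g := g) (N := n) fun i hi _ ↦ h i hi)
    n n.lt_succ_self
  rwa [map_sub, sub_eq_zero] at this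

lemma one_sub_mul_prod_Icc (a : K⟦X⟧) {m : ℕ} (hm : 1 ≤ m) :
    (1 - a * X) * ∏ i ∈ Icc 2 m, (1 - a * X ^ i) = qPoch (a * X) m := by
  induction m, hm using Nat.le_induction with
  | base => simp [qPoch]
  | succ m hm ih =>
    rw [prod_Icc_succ_top (by lia), ← mul_assoc, ih, qPoch_succ]
    ring

lemma weightedGenFun_boundedWeight {m : ℕ} (hm : 1 ≤ m) :
    weightedGenFun (boundedWeight K m) = (1 - X) * (qPoch X m)⁻¹ := by
  have h₁ := weightedGenFun_mul_prod (boundedWeight K m) (s := Icc 2 m) (by simp)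
  rw [weightedGenFun_eq_one (g := fun i ↦ if i ∈ Icc 2 m then 0 else boundedWeight K m i)
    fun i _ ↦ by simp only [boundedWeight, mem_Icc, ite_eq_left_iff]; simp_all] at h₁
  have h₂ := one_sub_mul_prod_Icc (1 : K⟦X⟧) hm
  have h₃ : ∏ i ∈ Icc 2 m, (1 - C (boundedWeight K m i) * X ^ i) =
      ∏ i ∈ Icc 2 m, (1 - 1 * X ^ i : K⟦X⟧) :=
    prod_congr rfl fun i hi ↦ by simp [boundedWeight, mem_Icc.1 hi]
  rw [h₃] at h₁
  rw [one_mul] at h₂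
  have h₄ := qPoch_X_mul_inv (K := K) m
  rw [← h₂] at h₄ ⊢
  linear_combination (1 - X) * ((1 - X) * ∏ i ∈ Icc 2 m, (1 - 1 * X ^ i))⁻¹ * h₁
    - weightedGenFun (boundedWeight K m) * h₄

lemma prod_largeWeight (z : K) {j N : ℕ} (hj : 1 ≤ j) (hjN : j ≤ N) :
    (1 - X) * qPoch (C z * X) j * ∏ i ∈ Icc 2 N, (1 - C (largeWeight z j i) * X ^ i) =
      qPoch X j * qPoch (C z * X) N := by
  induction N, hjN using Nat.le_induction with
  | base =>
    have h₁ := one_sub_mul_prod_Icc (1 : K⟦X⟧) hj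
    have h₂ : ∏ i ∈ Icc 2 j, (1 - C (largeWeight z j i) * X ^ i) =
        ∏ i ∈ Icc 2 j, (1 - 1 * X ^ i : K⟦X⟧) :=
      prod_congr rfl fun i hi ↦ by
        have := mem_Icc.1 hi
        rw [largeWeight, if_neg (by lia), if_neg (by lia), map_one]
    rw [one_mul] at h₁
    rw [h₂, ← h₁]
    ring
  | succ N h ih =>
    rw [prod_Icc_succ_top (by lia), ← mul_assoc, ih, qPoch_succ, largeWeight, if_neg (by lia),
      if_pos (by lia)]
    ring

lemma X_pow_dvd_largeWeight_sub (z : K) {j N : ℕ} (hj : 1 ≤ j) (hjN : j ≤ N) :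
    X ^ (N + 1) ∣ weightedGenFun (largeWeight z j) * qPoch (C z * X) N
      - (1 - X) * (qPoch (C z * X) j * (qPoch X j)⁻¹) := by
  have h₁ := weightedGenFun_mul_prod (largeWeight z j) (s := Icc 2 N) (by simp)
  obtain ⟨c, hc⟩ : X ^ (N + 1) ∣ weightedGenFun
      (fun i ↦ if i ∈ Icc 2 N then 0 else largeWeight z j i) - 1 := by
    refine X_pow_dvd_weightedGenFun_sub_one fun i h₁ h₂ ↦ ?_
    split_ifs with h
    · rfl
    · exact if_pos (by simp at h; lia)
  rw [← h₁] at hc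
  have h₂ := prod_largeWeight z hj hjN
  have h₃ := qPoch_X_mul_inv (K := K) j
  exact ⟨(1 - X) * qPoch (C z * X) j * (qPoch X j)⁻¹ * c, by
    linear_combination (1 - X) * qPoch (C z * X) j * (qPoch X j)⁻¹ * hc
      - weightedGenFun (largeWeight z j) * (qPoch X j)⁻¹ * h₂
      - weightedGenFun (largeWeight z j) * qPoch (C z * X) N * h₃⟩

lemma mul_coeff_sub (z : K) (f : K⟦X⟧) {n m : ℕ} (h : m ≤ n) :
    z ^ m * f.coeff (n - m) = ((C z * X) ^ m * f).coeff n := by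
  rw [mul_pow, mul_assoc, ← map_pow, coeff_C_mul, coeff_X_pow_mul', if_pos h]

/-- The crank generating function `(q; q) / ((z q; q) (z⁻¹ q; q))`, modulo `X ^ (N + 1)`. -/
lemma exists_crankGenFun {z : K} (hz : z ≠ 0) {N : ℕ} (hN : 2 ≤ N) :
    ∃ G : K⟦X⟧, G.coeff N = ∑ p : N.Partition, z ^ partitionCrank p ∧
      X ^ (N + 1) ∣ G * (qPoch (C z * X) N * qPoch (C z⁻¹ * X) N) - qPoch X N := by
  set S : K⟦X⟧ := ∑ j ∈ range (N + 1), qPoch 0 j * (qPoch X j)⁻¹ * (C z * X) ^ j with hS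
  set T : K⟦X⟧ := ∑ j ∈ range (N + 1),
    qPoch (C z * X) j * (qPoch X j)⁻¹ * (C z⁻¹ * X) ^ j with hT
  set L : K⟦X⟧ := ∑ j ∈ Icc 1 N, (C z⁻¹ * X) ^ j * weightedGenFun (largeWeight z j) with hL
  refine ⟨(1 - X) * S + L, ?_, ?_⟩
  · rw [sum_crank hz hN, map_add]
    congr 1
    · rw [hS, mul_sum, map_sum]
      symm
      have hsub : Icc 2 N ⊆ range (N + 1) := fun i hi ↦ by
        have := mem_Icc.1 hi
        exact mem_range.2 (by lia)
      rw [← sum_subset hsub]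
      · refine sum_congr rfl fun m hm ↦ ?_
        have := mem_Icc.1 hm
        rw [mul_coeff_sub z _ this.2, weightedGenFun_boundedWeight (by lia)]
        congr 1
        simp [qPoch]
        ring
      · intro m hm hm'
        have hm'' : m = 0 ∨ m = 1 := by
          rw [mem_Icc] at hm'
          rw [mem_range] at hm
          lia
        rcases hm'' with rfl | rfl
        · simp [coeff_X, coeff_one, show N ≠ 0 by lia, show N ≠ 1 by lia]
        · have h := qPoch_X_mul_inv (K := K) 1
          have e : (1 - X) * (qPoch 0 1 * (qPoch X 1)⁻¹ * (C z * X) ^ 1) = C z * X := by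
            simp only [qPoch, range_one, prod_singleton, pow_zero, mul_one, zero_mul, sub_zero,
              one_mul, pow_one] at h ⊢
            linear_combination C z * X * h
          rw [e, coeff_C_mul, coeff_X, if_neg (by lia), mul_zero]
    · rw [hL, map_sum]
      exact sum_congr rfl fun j hj ↦ (mul_coeff_sub _ _ (mem_Icc.1 hj).2).symm
  · have hzz : (C z * C z⁻¹ : K⟦X⟧) = 1 := by rw [← map_mul, mul_inv_cancel₀ hz, map_one]
    obtain ⟨c, hc⟩ := qBinomial 0 (C z : K⟦X⟧) N
    obtain ⟨d, hd⟩ := qBinomial (C z * X) (C z⁻¹ : K⟦X⟧) N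
    obtain ⟨e, he⟩ := X_pow_dvd_qPoch_sub (K := K) N.le_succ
    have hLT : X ^ (N + 1) ∣ L * qPoch (C z * X) N - (1 - X) * (T - 1) := by
      have hT' : T - 1 = ∑ j ∈ Icc 1 N,
          qPoch (C z * X) j * (qPoch X j)⁻¹ * (C z⁻¹ * X) ^ j := by
        rw [hT, range_eq_Ico, sum_eq_sum_Ico_succ_bot (by lia)]
        simp
        rfl
      rw [hT', hL, sum_mul, mul_sum, ← sum_sub_distrib]
      refine dvd_sum fun j hj ↦ ?_
      have hj := mem_Icc.1 hj
      refine (X_pow_dvd_largeWeight_sub z hj.1 hj.2).trans ⟨(C z⁻¹ * X) ^ j, ?_⟩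
      ring
    obtain ⟨f, hf⟩ := hLT
    rw [← hS] at hc
    rw [← hT] at hd
    have h₀ : qPoch (0 * (C z * X)) N = (1 : K⟦X⟧) := by simp [qPoch]
    have h₁ : C z * X * (C z⁻¹ * X) = (X * X : K⟦X⟧) := by linear_combination X * X * hzz
    rw [h₀] at hc
    rw [h₁] at hd
    rw [Nat.succ_eq_add_one, qPoch_succ'] at he
    refine ⟨(1 - X) * qPoch (C z⁻¹ * X) N * c + qPoch (C z⁻¹ * X) N * f + (1 - X) * d + e, ?_⟩
    linear_combination (1 - X) * qPoch (C z⁻¹ * X) N * hc + qPoch (C z⁻¹ * X) N * hf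
      + (1 - X) * hd + he

end CrankGenFun

section FifthRoots

variable {K : Type*} [Field K]

lemma coeff_qPoch_X_eq_zero {N c : ℕ} (hc : c ≤ N) (h : 3 ≤ c % 5) :
    (qPoch (X : K⟦X⟧) N).coeff c = 0 := by
  obtain ⟨s₀, hs₀⟩ := Filter.eventually_atTop.1 (coeff_prod_one_sub_X_pow_eventually_eq K c)
  obtain ⟨M, hM⟩ := s₀.exists_nat_subset_range
  have h₁ := hs₀ (range (max M N)) (hM.trans (range_mono (le_max_left _ _)))
  have h₂ : ∏ n ∈ range (max M N), (1 - X ^ (n + 1) : K⟦X⟧) = qPoch X (max M N) :=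
    prod_congr rfl fun i _ ↦ by rw [pow_succ']
  have h₃ := X_pow_dvd_iff.1 (X_pow_dvd_qPoch_sub (K := K) (le_max_right M N)) c (by lia)
  rw [map_sub, sub_eq_zero] at h₃
  rw [← h₃, ← h₂, h₁, coeff_pentagonalSeries_eq_zero]
  rintro ⟨k, rfl⟩
  have hk : (2 * pentagonal k : ℤ) = k * (3 * k - 1) := by
    exact two_mul_natCast_pentagonal k
  have hk5 : (k % 5 = 0 ∨ k % 5 = 1 ∨ k % 5 = 2 ∨ k % 5 = 3 ∨ k % 5 = 4) := by lia
  have h₄ := congrArg (· % 5) hk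
  simp only [Int.mul_emod k, Int.sub_emod (3 * k), Int.mul_emod 3 k] at h₄
  rcases hk5 with h | h | h | h | h <;> rw [h] at h₄ <;> norm_num at h₄ <;> lia

lemma laurentSum_eq_zero {w : K} (h₅ : w ^ 5 = 1) {j : ℕ} (hj : j % 5 = 2) :
    laurentSum w j = 0 := by
  have h₀ : w ≠ 0 := by rintro rfl; simp at h₅
  rw [laurentSum, ← Nat.div_add_mod j 5, hj, pow_add w⁻¹, pow_mul w⁻¹, inv_pow, h₅, inv_one,
    one_pow, one_mul, add_assoc, pow_add, pow_mul, h₅, one_pow, one_mul]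
  rw [show w ^ (2 + 1) - w⁻¹ ^ 2 = 0 by field_simp; linear_combination h₅, zero_div]

lemma coeff_laurentSum_series_eq_zero {w : K} (h₅ : w ^ 5 = 1) (N : ℕ) {d : ℕ}
    (h : 2 ≤ d % 5) :
    (∑ j ∈ range (N + 1),
      (-1) ^ j * X ^ (j * (j + 1) / 2) * C (laurentSum w j) : K⟦X⟧).coeff d = 0 := by
  rw [map_sum]
  refine sum_eq_zero fun j _ ↦ ?_
  rw [coeff_mul_C]
  by_cases hj : j % 5 = 2
  · rw [laurentSum_eq_zero h₅ hj, mul_zero]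
  · have hd : d ≠ j * (j + 1) / 2 := by
      intro hd
      have h₁ : 2 * d = j * (j + 1) := by
        rw [hd]
        exact Nat.mul_div_cancel' (Nat.even_mul_succ_self j).two_dvd
      have h₂ := congrArg (· % 5) h₁
      simp only [Nat.mul_mod j, Nat.add_mod j 1] at h₂
      have hj5 : j % 5 = 0 ∨ j % 5 = 1 ∨ j % 5 = 3 ∨ j % 5 = 4 := by lia
      rcases hj5 with h | h | h | h <;> rw [h] at h₂ <;> norm_num at h₂ <;> lia
    rw [← map_one (C (R := K)), ← map_neg, ← map_pow, coeff_C_mul, coeff_X_pow, if_neg hd]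
    simp

lemma prod_qPoch_fifth_roots {z : K} (h₅ : z ^ 5 = 1) (h₁ : z ≠ 1) (N : ℕ) :
    qPoch X N * (qPoch (C z * X) N * qPoch (C z⁻¹ * X) N) *
      (qPoch (C (z ^ 2) * X) N * qPoch (C (z ^ 2)⁻¹ * X) N) =
      expand 5 (by simp) (qPoch (X : K⟦X⟧) N) := by
  have h₄ : z ^ 4 + z ^ 3 + z ^ 2 + z + 1 = 0 :=
    mul_left_cancel₀ (sub_ne_zero.2 h₁) (by linear_combination h₅)
  have i₁ : z⁻¹ = z ^ 4 := inv_eq_of_mul_eq_one_right (by linear_combination h₅)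
  have i₂ : (z ^ 2)⁻¹ = z ^ 3 := inv_eq_of_mul_eq_one_right (by linear_combination h₅)
  have hC : (C z : K⟦X⟧) ^ 4 + C z ^ 3 + C z ^ 2 + C z + 1 = 0 := by
    simpa using congrArg (C (R := K)) h₄
  rw [i₁, i₂]
  simp only [qPoch, ← prod_mul_distrib, map_prod, map_sub, map_one, map_mul, map_pow, expand_X]
  refine prod_congr rfl fun i _ ↦ ?_
  generalize (C z : K⟦X⟧) = c at hC
  have hy : (X : K⟦X⟧) ^ 5 * (X ^ 5) ^ i = (X * X ^ i) ^ 5 := by ring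
  rw [hy]
  have h₅' : c ^ 5 = 1 := by linear_combination (c - 1) * hC
  have hst : (c + c ^ 4) * (c ^ 2 + c ^ 3) = -1 := by linear_combination hC + (c + c ^ 2) * h₅'
  have hs : c + c ^ 4 + (c ^ 2 + c ^ 3) = -1 := by linear_combination hC
  have e₁ (y : K⟦X⟧) : (1 - c * y) * (1 - c ^ 4 * y) = 1 - (c + c ^ 4) * y + y ^ 2 := by
    linear_combination y ^ 2 * h₅'
  have e₂ (y : K⟦X⟧) : (1 - c ^ 2 * y) * (1 - c ^ 3 * y) = 1 - (c ^ 2 + c ^ 3) * y + y ^ 2 := by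
    linear_combination y ^ 2 * h₅'
  generalize c + c ^ 4 = s at *
  generalize c ^ 2 + c ^ 3 = t at *
  simp only [mul_assoc c, mul_assoc (c ^ _)]
  generalize (X : K⟦X⟧) * X ^ i = y
  rw [e₁, e₂]
  linear_combination (1 - y) * (-y * (1 + y ^ 2) * hs + y ^ 2 * hst)

/-- The crank polynomial of `5 * n + 4` vanishes at every nontrivial fifth root of unity. -/
theorem sum_crank_eq_zero {z : K} (h₅ : z ^ 5 = 1) (h₁ : z ≠ 1) (n : ℕ) :
    ∑ p : (5 * n + 4).Partition, z ^ partitionCrank p = 0 := by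
  have h₀ : z ≠ 0 := by rintro rfl; simp at h₅
  have hw₁ : z ^ 2 ≠ 1 := fun h ↦ h₁ (by linear_combination h₅ - (z ^ 3 + z) * h)
  have hw₅ : (z ^ 2) ^ 5 = 1 := by rw [← pow_mul, mul_comm, pow_mul, h₅, one_pow]
  obtain ⟨G, hG, c, hc⟩ := exists_crankGenFun h₀ (N := 5 * n + 4) (by lia)
  obtain ⟨d, hd⟩ := X_pow_dvd_triple_sub (pow_ne_zero 2 h₀) hw₁ (5 * n + 4)
  have hD := prod_qPoch_fifth_roots h₅ h₁ (5 * n + 4)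
  have hE : expand 5 (by simp) (qPoch (X : K⟦X⟧) (5 * n + 4)) *
      expand 5 (by simp) (qPoch (X : K⟦X⟧) (5 * n + 4))⁻¹ = 1 := by
    rw [← map_mul, qPoch_X_mul_inv, map_one]
  have hJ := fun m (hm : 2 ≤ m % 5) ↦ coeff_laurentSum_series_eq_zero hw₅ (5 * n + 4) hm
  have hQ := fun m (hm : m ≤ 5 * n + 4) (hm' : 3 ≤ m % 5) ↦ coeff_qPoch_X_eq_zero (K := K) hm hm'
  have hE₀ : ∀ m, m % 5 ≠ 0 →
      (expand 5 (by simp) (qPoch (X : K⟦X⟧) (5 * n + 4))⁻¹).coeff m = 0 := fun m hm ↦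
    coeff_expand_of_not_dvd _ _ _ (by lia)
  rw [← hG]
  generalize (∑ j ∈ range (5 * n + 4 + 1),
      (-1) ^ j * X ^ (j * (j + 1) / 2) * C (laurentSum (z ^ 2) j) : K⟦X⟧) = J at *
  generalize expand 5 (by simp) (qPoch (X : K⟦X⟧) (5 * n + 4))⁻¹ = E at *
  rw [← hD] at hE
  generalize qPoch (X : K⟦X⟧) (5 * n + 4) = Q at *
  generalize qPoch (C z * X) (5 * n + 4) * qPoch (C z⁻¹ * X) (5 * n + 4) = A at *
  generalize qPoch (C (z ^ 2) * X) (5 * n + 4) * qPoch (C (z ^ 2)⁻¹ * X) (5 * n + 4) = B at *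
  have hdvd : X ^ (5 * n + 4 + 1) ∣ G - Q * J * E :=
    ⟨Q * B * E * c + Q * E * d, by
      linear_combination Q * B * E * hc + Q * E * hd - G * hE⟩
  have h := X_pow_dvd_iff.1 hdvd (5 * n + 4) (by lia)
  rw [map_sub, sub_eq_zero] at h
  rw [h, coeff_mul]
  refine sum_eq_zero fun x hx ↦ ?_
  rw [HasAntidiagonal.mem_antidiagonal] at hx
  by_cases h5 : x.2 % 5 = 0
  · rw [coeff_mul, sum_eq_zero, zero_mul]
    intro y hy
    rw [HasAntidiagonal.mem_antidiagonal] at hy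
    by_cases h3 : 3 ≤ y.1 % 5
    · rw [hQ _ (by lia) h3, zero_mul]
    · rw [hJ _ (by lia), mul_zero]
  · rw [hE₀ _ h5, mul_zero]

end FifthRoots

end CrankModFive

/-- **Andrews–Garvan mod 5**: for every `n ≥ 0` and every `0 ≤ k ≤ 4`, the number of
partitions of `5n + 4` with crank congruent to `k` modulo `5` equals `p(5n+4) / 5`. -/
theorem crank_equidistribution_mod_five (n : ℕ) (k : ℤ) (hk0 : 0 ≤ k) (hk4 : k ≤ 4) :
    ((Finset.univ.filter
        (fun p : Nat.Partition (5 * n + 4) => partitionCrank p % 5 = k)).card : ℚ) =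
      (Fintype.card (Nat.Partition (5 * n + 4)) : ℚ) / 5 := by
  obtain ⟨ζ, hζ⟩ : ∃ ζ : ℂ, IsPrimitiveRoot ζ 5 :=
    ⟨_, Complex.isPrimitiveRoot_exp 5 (by norm_num)⟩
  have hζ₀ : ζ ≠ 0 := hζ.ne_zero (by norm_num)
  have hgeom (p : Nat.Partition (5 * n + 4)) :
      ∑ m ∈ Finset.range 5, (ζ ^ (partitionCrank p - k)) ^ m =
        if partitionCrank p % 5 = k then 5 else 0 := by
    have hiff : ζ ^ (partitionCrank p - k) = 1 ↔ partitionCrank p % 5 = k := by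
      rw [hζ.zpow_eq_one_iff_dvd]
      push_cast
      omega
    split_ifs with h
    · rw [hiff.2 h]; simp
    · have hu : (ζ ^ (partitionCrank p - k)) ^ 5 = 1 := by
        rw [← zpow_natCast, ← zpow_mul, mul_comm, zpow_mul, zpow_natCast, hζ.pow_eq_one, one_zpow]
      rw [geom_sum_eq (mt hiff.1 h), hu, sub_self, zero_div]
  have hzero : ∀ m ∈ Finset.range 4,
      ∑ p : Nat.Partition (5 * n + 4), (ζ ^ (partitionCrank p - k)) ^ (m + 1) = 0 := by
    intro m hm
    have hm := Finset.mem_range.1 hm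
    have h := CrankModFive.sum_crank_eq_zero (z := ζ ^ (m + 1))
      (by rw [← pow_mul, mul_comm, pow_mul, hζ.pow_eq_one, one_pow])
      (hζ.pow_ne_one_of_pos_of_lt (by lia) (by lia)) n
    rw [← zero_mul ((ζ ^ (m + 1)) ^ (-k)), ← h, Finset.sum_mul]
    refine Finset.sum_congr rfl fun p _ ↦ ?_
    rw [← zpow_add₀ (pow_ne_zero _ hζ₀), ← sub_eq_add_neg, ← zpow_natCast, ← zpow_natCast,
      ← zpow_mul, ← zpow_mul, mul_comm]
  have key : ((Finset.univ.filter
      (fun p : Nat.Partition (5 * n + 4) => partitionCrank p % 5 = k)).card : ℂ) * 5 =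
      Fintype.card (Nat.Partition (5 * n + 4)) := by
    calc _ = ∑ p : Nat.Partition (5 * n + 4),
          ∑ m ∈ Finset.range 5, (ζ ^ (partitionCrank p - k)) ^ m := by
            rw [Finset.sum_congr rfl fun p _ ↦ hgeom p, ← Finset.sum_filter, Finset.sum_const,
              nsmul_eq_mul]
      _ = _ := by
        rw [Finset.sum_comm, Finset.sum_range_succ', Finset.sum_eq_zero hzero]
        simp
  rw [eq_div_iff (by norm_num)]
  exact_mod_cast key
end

section
/- For every nonnegative integer n and every k with 0 ≤ k ≤ 6, the number of partitions of 7n+5 whose crank is congruent to k modulo 7 equals p(7n+5)/7; that is, M(k,7,7n+5) = p(7n+5)/7. -/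
open Finset PowerSeries

section QSeries

variable {A : Type*} [CommRing A]

/-- The coefficients `∏_{i < m} (1 - a q ^ i) / (1 - q ^ (i + 1))` of the `q`-binomial series. -/
noncomputable def qBinomialCoeff (q a : A) : ℕ → A
  | 0 => 1
  | m + 1 => Ring.inverse (1 - q ^ (m + 1)) * ((1 - a * q ^ m) * qBinomialCoeff q a m)

/-- The product `∏_{i = 1}^N (1 - x q ^ i)`. -/
def qProd (q x : A) (N : ℕ) : A := ∏ i ∈ range N, (1 - x * q ^ (i + 1))

lemma qProd_succ (q x : A) (N : ℕ) :
    qProd q x (N + 1) = qProd q x N * (1 - x * q ^ (N + 1)) := prod_range_succ _ _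

lemma isUnit_one_sub_mul_pow_succ {q : A} (hq : IsNilpotent q) (x : A) (m : ℕ) :
    IsUnit (1 - x * q ^ (m + 1)) := by
  refine IsNilpotent.isUnit_one_sub ?_
  exact (Commute.all _ _).isNilpotent_mul_left (hq.pow_of_pos (by omega))

lemma isUnit_qProd {q : A} (hq : IsNilpotent q) (x : A) (N : ℕ) : IsUnit (qProd q x N) :=
  IsUnit.prod_iff.2 fun i _ => isUnit_one_sub_mul_pow_succ hq x i

lemma qProd_eq_of_le {q : A} {M N : ℕ} (hq : q ^ M = 0) (x : A) (h : M ≤ N) :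
    qProd q x N = qProd q x M := by
  induction N, h using Nat.le_induction with
  | base => rfl
  | succ n hn ih => rw [qProd_succ, ih, pow_eq_zero_of_le (by omega) hq]; ring

lemma one_sub_pow_mul_qBinomialCoeff_succ {q : A} (hq : IsNilpotent q) (a : A) (m : ℕ) :
    (1 - q ^ (m + 1)) * qBinomialCoeff q a (m + 1) = (1 - a * q ^ m) * qBinomialCoeff q a m := by
  rw [qBinomialCoeff, Ring.mul_inverse_cancel_left]
  simpa using isUnit_one_sub_mul_pow_succ hq 1 m

lemma qProd_one_mul_qBinomialCoeff {q : A} (hq : IsNilpotent q) (x : A) (m : ℕ) :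
    qProd q 1 m * qBinomialCoeff q (x * q) m = qProd q x m := by
  induction m with
  | zero => simp [qProd, qBinomialCoeff]
  | succ m ih =>
    rw [qProd_succ, qProd_succ, ← ih]
    have := one_sub_pow_mul_qBinomialCoeff_succ hq (x * q) m
    linear_combination qProd q 1 m * this

lemma qBinomial_functional_equation {q : A} {M : ℕ} (hq : q ^ M = 0) (a s : A) :
    (1 - s * q) * ∑ m ∈ range M, qBinomialCoeff q a m * (s * q) ^ m =
      (1 - a * (s * q)) * ∑ m ∈ range M, qBinomialCoeff q a m * (s * q * q) ^ m := by
  have hext (t : A) : ∑ m ∈ range M, qBinomialCoeff q a m * (t * q) ^ m =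
      ∑ m ∈ range (M + 1), qBinomialCoeff q a m * (t * q) ^ m := by
    rw [sum_range_succ, mul_pow, hq]; simp
  have hsub : ∑ m ∈ range M, qBinomialCoeff q a m * (s * q) ^ m -
      ∑ m ∈ range M, qBinomialCoeff q a m * (s * q * q) ^ m =
      s * q * ∑ m ∈ range M, qBinomialCoeff q a m * (s * q) ^ m -
      a * (s * q) * ∑ m ∈ range M, qBinomialCoeff q a m * (s * q * q) ^ m := by
    conv_lhs => rw [hext s, hext (s * q), ← sum_sub_distrib, sum_range_succ']
    rw [mul_sum, mul_sum, ← sum_sub_distrib]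
    simp only [pow_zero, sub_self, add_zero]
    refine sum_congr rfl fun m _ => ?_
    have := one_sub_pow_mul_qBinomialCoeff_succ ⟨M, hq⟩ a m
    rw [mul_pow (s * q) q (m + 1), mul_pow (s * q) q m]
    linear_combination (s * q) ^ (m + 1) * this
  linear_combination hsub

/-- The `q`-binomial theorem for a nilpotent `q`. -/
theorem qBinomial_theorem {q : A} {M : ℕ} (hM : 0 < M) (hq : q ^ M = 0) (a s : A) :
    (∑ m ∈ range M, qBinomialCoeff q a m * (s * q) ^ m) * qProd q s M = qProd q (a * s) M := by
  have key (N : ℕ) : (∑ m ∈ range M, qBinomialCoeff q a m * (s * q) ^ m) * qProd q s N =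
      qProd q (a * s) N * ∑ m ∈ range M, qBinomialCoeff q a m * (s * q ^ N * q) ^ m := by
    induction N with
    | zero => simp [qProd]
    | succ N ih =>
      have h := qBinomial_functional_equation hq a (s * q ^ N)
      rw [show s * q ^ N * q * q = s * q ^ (N + 1) * q by ring] at h
      rw [qProd_succ, qProd_succ]
      linear_combination (1 - s * q ^ (N + 1)) * ih + qProd q (a * s) N * h
  obtain ⟨L, rfl⟩ := Nat.exists_eq_add_of_lt hM
  rw [key, hq, sum_eq_single 0]
  · simp [qBinomialCoeff]
  · intro b _ hb
    simp [hb]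
  · simp

/-- The coefficients of the finite form of the Jacobi triple product. -/
def thetaCoeff (q : A) : ℕ → ℕ → A
  | 0, 0 => 1
  | 0, _ + 1 => 0
  | n + 1, 0 => (1 + q ^ (2 * n + 2) + q ^ (n + 1)) * thetaCoeff q n 0 -
      q ^ (n + 1) * thetaCoeff q n 1
  | n + 1, j + 1 => (1 + q ^ (2 * n + 2)) * thetaCoeff q n (j + 1) -
      q ^ (n + 1) * (thetaCoeff q n j + thetaCoeff q n (j + 2))

lemma thetaCoeff_eq_zero (q : A) {n j : ℕ} (h : n < j) : thetaCoeff q n j = 0 := by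
  induction n generalizing j with
  | zero => obtain ⟨j, rfl⟩ := Nat.exists_eq_add_of_lt h; simp [thetaCoeff]
  | succ n ih =>
    obtain ⟨j, rfl⟩ := Nat.exists_eq_add_one_of_ne_zero (Nat.ne_zero_of_lt h)
    rw [thetaCoeff, ih (by omega), ih (by omega), ih (by omega)]; ring

lemma one_sub_mul_qProd_mul_qProd (q : A) {z w : A} (h : z * w = 1) (n : ℕ) :
    (1 - z) * (qProd q z n * qProd q w n) =
      ∑ j ∈ range (n + 1), thetaCoeff q n j * (w ^ j - z ^ (j + 1)) := by
  induction n with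
  | zero => simp [qProd, thetaCoeff]
  | succ n ih =>
    have hu (j : ℕ) : (z + w) * (w ^ (j + 1) - z ^ (j + 2)) =
        (w ^ (j + 2) - z ^ (j + 3)) + (w ^ j - z ^ (j + 1)) := by
      linear_combination (w ^ j - z ^ (j + 1)) * h
    have hext : ∑ j ∈ range (n + 1), thetaCoeff q n j * (w ^ j - z ^ (j + 1)) =
        ∑ j ∈ range (n + 2), thetaCoeff q n j * (w ^ j - z ^ (j + 1)) := by
      rw [sum_range_succ _ (n + 1), thetaCoeff_eq_zero q (Nat.lt_succ_self n)]; ring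
    have hK0 : thetaCoeff q n (n + 1) = 0 := thetaCoeff_eq_zero q (by omega)
    have hK1 : thetaCoeff q n (n + 2) = 0 := thetaCoeff_eq_zero q (by omega)
    have e1 : ∑ j ∈ range (n + 1), thetaCoeff q n j * (w ^ (j + 1) - z ^ (j + 2)) +
        ∑ j ∈ range (n + 1), thetaCoeff q n (j + 2) * (w ^ (j + 1) - z ^ (j + 2)) +
        thetaCoeff q n 1 * (1 - z) - thetaCoeff q n 0 * (1 - z) =
        (z + w) * ∑ j ∈ range (n + 1), thetaCoeff q n j * (w ^ j - z ^ (j + 1)) := by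
      rw [sum_range_succ (fun j => thetaCoeff q n (j + 2) * _), hK1]
      have e2 := sum_range_succ' (fun j => thetaCoeff q n (j + 1) * (w ^ j - z ^ (j + 1))) n
      have e3 : ∑ j ∈ range (n + 1), thetaCoeff q n (j + 1) * (w ^ j - z ^ (j + 1)) =
          ∑ j ∈ range n, thetaCoeff q n (j + 1) * (w ^ j - z ^ (j + 1)) := by
        rw [sum_range_succ, hK0]; ring
      have e4 : ∑ j ∈ range n, (z + w) * (thetaCoeff q n (j + 1) * (w ^ (j + 1) - z ^ (j + 2))) =
          ∑ j ∈ range n, thetaCoeff q n (j + 1) * (w ^ (j + 2) - z ^ (j + 3)) +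
          ∑ j ∈ range n, thetaCoeff q n (j + 1) * (w ^ j - z ^ (j + 1)) := by
        rw [← sum_add_distrib]
        exact sum_congr rfl fun j _ => by linear_combination thetaCoeff q n (j + 1) * hu j
      rw [← mul_sum] at e4
      rw [sum_range_succ', sum_range_succ' _ n]
      simp only [zero_add, pow_zero, pow_one] at e2 e3 e4 ⊢
      linear_combination e3 - e2 - e4 + thetaCoeff q n 0 * h
    rw [sum_range_succ']
    simp only [thetaCoeff, qProd_succ]
    have e5 : ∑ j ∈ range (n + 1), ((1 + q ^ (2 * n + 2)) * thetaCoeff q n (j + 1) -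
        q ^ (n + 1) * (thetaCoeff q n j + thetaCoeff q n (j + 2))) *
          (w ^ (j + 1) - z ^ (j + 1 + 1)) =
        (1 + q ^ (2 * n + 2)) *
          ∑ j ∈ range (n + 1), thetaCoeff q n (j + 1) * (w ^ (j + 1) - z ^ (j + 2)) -
        q ^ (n + 1) * (∑ j ∈ range (n + 1), thetaCoeff q n j * (w ^ (j + 1) - z ^ (j + 2)) +
        ∑ j ∈ range (n + 1), thetaCoeff q n (j + 2) * (w ^ (j + 1) - z ^ (j + 2))) := by
      rw [← sum_add_distrib, mul_sum, mul_sum, ← sum_sub_distrib]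
      exact sum_congr rfl fun j _ => by ring
    rw [e5]
    have e6 := sum_range_succ' (fun j => thetaCoeff q n j * (w ^ j - z ^ (j + 1))) (n + 1)
    simp only [zero_add, pow_zero, pow_one, add_assoc, Nat.reduceAdd] at e6 hext ih e1 ⊢
    rw [← hext] at e6
    linear_combination (1 - z * q ^ (n + 1)) * (1 - w * q ^ (n + 1)) * ih + q ^ (n + 1) * e1 +
      (1 + q ^ (2 * n + 2)) * e6 + q ^ (2 * n + 2) * h *
        ∑ j ∈ range (n + 1), thetaCoeff q n j * (w ^ j - z ^ (j + 1))

lemma thetaCoeff_mul_qProd_mul_qProd (q : A) {n j : ℕ} (h : j ≤ n) :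
    thetaCoeff q n j * (qProd q 1 (n - j) * qProd q 1 (n + 1 + j)) =
      (-1) ^ j * q ^ (∑ i ∈ range (j + 1), i) * qProd q 1 (2 * n + 1) := by
  induction n generalizing j with
  | zero => obtain rfl : j = 0 := by omega
            simp [thetaCoeff, qProd]
  | succ n ih =>
    have hE (m : ℕ) : qProd q 1 (m + 1) = qProd q 1 m * (1 - q ^ (m + 1)) := by
      rw [qProd_succ, one_mul]
    have hE2 : qProd q 1 (2 * (n + 1) + 1) =
        qProd q 1 (2 * n + 1) * (1 - q ^ (2 * n + 2)) * (1 - q ^ (2 * n + 3)) := by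
      rw [show 2 * (n + 1) + 1 = 2 * n + 1 + 1 + 1 by ring, hE, hE]
    rw [hE2]
    have hT (m : ℕ) : q ^ (∑ i ∈ range (m + 1), i) = q ^ (∑ i ∈ range m, i) * q ^ m := by
      rw [sum_range_succ, pow_add]
    rcases j with _ | j
    · have h0 := ih (Nat.zero_le n)
      rcases n with _ | n
      · simp [thetaCoeff, qProd, prod_range_succ]
        ring
      · have h1 := ih (show 1 ≤ n + 1 by omega)
        simp only [Nat.add_sub_cancel, tsub_zero, add_zero, hE, hT, thetaCoeff, pow_zero,
          pow_one, range_zero, sum_empty, zero_add, ← two_mul] at h0 h1 ⊢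
        linear_combination (1 + q ^ (2 * n + 4) + q ^ (n + 2)) * (1 - q ^ (n + 2)) *
          (1 - q ^ (n + 3)) * h0 - q ^ (n + 2) * (1 - q ^ (n + 1)) * (1 - q ^ (n + 2)) * h1
    · obtain ⟨d, rfl⟩ := Nat.exists_eq_add_of_le (Nat.le_of_succ_le_succ h)
      have h0 := ih (show j ≤ j + d by omega)
      rcases d with _ | _ | d
      · simp only [add_zero] at h0 ⊢
        rw [thetaCoeff, thetaCoeff_eq_zero q (show j < j + 1 by omega),
          thetaCoeff_eq_zero q (show j < j + 2 by omega)]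
        simp only [Nat.sub_self] at h0 ⊢
        rw [show j + 1 + 1 + (j + 1) = j + 1 + j + 1 + 1 by ring, hE, hE, hT (j + 1)]
        linear_combination -q ^ (j + 1) * (1 - q ^ (2 * j + 2)) * (1 - q ^ (2 * j + 3)) * h0
      · have h1 := ih (show j + 1 ≤ j + (0 + 1) by omega)
        rw [thetaCoeff, thetaCoeff_eq_zero q (show j + (0 + 1) < j + 2 by omega)]
        rw [show j + (0 + 1) - j = 0 + 1 by omega, hE,
          show j + (0 + 1) + 1 + j = j + j + 2 by ring] at h0
        rw [show j + (0 + 1) - (j + 1) = 0 by omega,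
          show j + (0 + 1) + 1 + (j + 1) = j + j + 2 + 1 by ring, hE, hT (j + 1)] at h1
        rw [show j + (0 + 1) + 1 - (j + 1) = 0 + 1 by omega, hE,
          show j + (0 + 1) + 1 + 1 + (j + 1) = j + j + 2 + 1 + 1 by ring, hE, hE, hT (j + 1)]
        linear_combination (1 + q ^ (2 * j + 4)) * (1 - q) * (1 - q ^ (2 * j + 4)) * h1 -
          q ^ (j + 2) * (1 - q ^ (2 * j + 3)) * (1 - q ^ (2 * j + 4)) * h0
      · have h1 := ih (show j + 1 ≤ j + (d + 1 + 1) by omega)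
        have h2 := ih (show j + 2 ≤ j + (d + 1 + 1) by omega)
        rw [thetaCoeff]
        rw [show j + (d + 1 + 1) - j = d + 1 + 1 by omega, hE, hE,
          show j + (d + 1 + 1) + 1 + j = j + j + d + 3 by ring] at h0
        rw [show j + (d + 1 + 1) - (j + 1) = d + 1 by omega, hE,
          show j + (d + 1 + 1) + 1 + (j + 1) = j + j + d + 3 + 1 by ring, hE, hT (j + 1)] at h1
        rw [show j + (d + 1 + 1) - (j + 2) = d by omega,
          show j + (d + 1 + 1) + 1 + (j + 2) = j + j + d + 3 + 1 + 1 by ring, hE, hE,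
          show j + 2 + 1 = j + 1 + 1 + 1 by ring, hT (j + 1 + 1), hT (j + 1)] at h2
        rw [show j + (d + 1 + 1) + 1 - (j + 1) = d + 1 + 1 by omega, hE, hE,
          show j + (d + 1 + 1) + 1 + 1 + (j + 1) = j + j + d + 3 + 1 + 1 by ring, hE, hE,
          hT (j + 1)]
        linear_combination (1 + q ^ (2 * j + 2 * d + 6)) * (1 - q ^ (d + 2)) *
            (1 - q ^ (2 * j + d + 5)) * h1 -
          q ^ (j + d + 3) * (1 - q ^ (2 * j + d + 4)) * (1 - q ^ (2 * j + d + 5)) * h0 -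
          q ^ (j + d + 3) * (1 - q ^ (d + 1)) * (1 - q ^ (d + 2)) * h2

/-- The Jacobi triple product identity for a nilpotent `q`. -/
theorem jacobi_triple_product {q : A} {M : ℕ} (hq : q ^ M = 0) {z w : A} (h : z * w = 1) :
    (1 - z) * (qProd q 1 M * qProd q z M * qProd q w M) =
      ∑ j ∈ range M, (-1) ^ j * q ^ (∑ i ∈ range (j + 1), i) * (w ^ j - z ^ (j + 1)) := by
  have hT (j : ℕ) : j ≤ ∑ i ∈ range (j + 1), i := by
    rw [sum_range_succ]; exact Nat.le_add_left _ _
  have hunit : IsUnit (qProd q 1 M) := isUnit_qProd ⟨M, hq⟩ 1 M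
  have hlarge {j : ℕ} (hj : M ≤ j) (hj' : j ≤ 2 * M) : thetaCoeff q (2 * M) j = 0 := by
    have := thetaCoeff_mul_qProd_mul_qProd q hj'
    rw [pow_eq_zero_of_le (hj.trans (hT j)) hq, mul_zero, zero_mul] at this
    exact ((isUnit_qProd ⟨M, hq⟩ 1 _).mul (isUnit_qProd ⟨M, hq⟩ 1 _)).mul_left_eq_zero.1 this
  have hsmall {j : ℕ} (hj : j < M) : qProd q 1 M * thetaCoeff q (2 * M) j =
      (-1) ^ j * q ^ (∑ i ∈ range (j + 1), i) := by
    have := thetaCoeff_mul_qProd_mul_qProd q (show j ≤ 2 * M by omega)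
    rw [qProd_eq_of_le hq 1 (show M ≤ 2 * M - j by omega),
      qProd_eq_of_le hq 1 (show M ≤ 2 * M + 1 + j by omega),
      qProd_eq_of_le hq 1 (show M ≤ 2 * (2 * M) + 1 by omega)] at this
    refine hunit.mul_right_cancel ?_
    linear_combination this
  have hfin := one_sub_mul_qProd_mul_qProd q h (2 * M)
  rw [qProd_eq_of_le hq z (show M ≤ 2 * M by omega),
    qProd_eq_of_le hq w (show M ≤ 2 * M by omega),
    ← sum_subset (range_subset_range.2 (show M ≤ 2 * M + 1 by omega))] at hfin
  · calc _ = qProd q 1 M * ((1 - z) * (qProd q z M * qProd q w M)) := by ring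
      _ = _ := by
        rw [hfin, mul_sum]
        refine sum_congr rfl fun j hj => ?_
        rw [← mul_assoc, hsmall (mem_range.1 hj)]
  · intro j hj hj'
    rw [hlarge (by simpa using hj') (by simpa [Nat.lt_succ_iff] using hj), zero_mul]

/-- The product of `1 - x z ^ i` over a full set of seventh roots of unity. -/
lemma one_sub_pow_seven_eq {z : A} (h7 : z ^ 7 = 1)
    (hz : 1 + z + z ^ 2 + z ^ 3 + z ^ 4 + z ^ 5 + z ^ 6 = 0) (x : A) :
    (1 - x) * ((1 - z * x) * (1 - z ^ 6 * x)) * ((1 - z ^ 2 * x) * (1 - z ^ 5 * x)) *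
      ((1 - z ^ 3 * x) * (1 - z ^ 4 * x)) = 1 - x ^ 7 := by
  have e1 : (1 - z * x) * (1 - z ^ 6 * x) = 1 - (z + z ^ 6) * x + x ^ 2 := by
    linear_combination x ^ 2 * h7
  have e2 : (1 - z ^ 2 * x) * (1 - z ^ 5 * x) = 1 - (z ^ 2 + z ^ 5) * x + x ^ 2 := by
    linear_combination x ^ 2 * h7
  have e3 : (1 - z ^ 3 * x) * (1 - z ^ 4 * x) = 1 - (z ^ 3 + z ^ 4) * x + x ^ 2 := by
    linear_combination x ^ 2 * h7
  have s1 : (z + z ^ 6) + (z ^ 2 + z ^ 5) + (z ^ 3 + z ^ 4) = -1 := by linear_combination hz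
  have s2 : (z + z ^ 6) * (z ^ 2 + z ^ 5) + (z + z ^ 6) * (z ^ 3 + z ^ 4) +
      (z ^ 2 + z ^ 5) * (z ^ 3 + z ^ 4) = -2 := by
    linear_combination 2 * hz + (z + z + 2 * z ^ 2 + z ^ 3 + z ^ 4) * h7
  have s3 : (z + z ^ 6) * (z ^ 2 + z ^ 5) * (z ^ 3 + z ^ 4) = 1 := by
    linear_combination hz + (1 + z ^ 2 + z ^ 3 + z ^ 4 + z ^ 5 + (1 + z) * (z ^ 7 + 1)) * h7
  rw [e1, e2, e3]
  generalize z + z ^ 6 = a at *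
  generalize z ^ 2 + z ^ 5 = b at *
  generalize z ^ 3 + z ^ 4 = c at *
  linear_combination (1 - x) * (-(1 + x ^ 2) ^ 2 * x * s1 + (1 + x ^ 2) * x ^ 2 * s2 - x ^ 3 * s3)
end QSeries

section CrankSeries

variable {A : Type*} [CommRing A]

lemma one_sub_mul_prod_ite_mul_qProd (q a b : A) {m N : ℕ} (hm : 1 ≤ m) (hmN : m ≤ N + 1) :
    (1 - a * q) * (∏ i ∈ range N, (1 - (if i + 2 ≤ m then a else b) * q ^ (i + 2))) *
      qProd q b m = qProd q a m * qProd q b (N + 1) := by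
  obtain ⟨k, rfl⟩ := Nat.exists_eq_add_of_le' hm
  have hkN : k ≤ N := by omega
  clear hmN
  induction N, hkN using Nat.le_induction with
  | base =>
    rw [prod_congr rfl fun i hi => by
      rw [if_pos (show i + 2 ≤ k + 1 by have := mem_range.1 hi; omega)]]
    congr 1
    rw [qProd, prod_range_succ', mul_comm]
    simp [add_assoc]
  | succ N hN ih =>
    rw [prod_range_succ, if_neg (by omega), qProd_succ _ _ (N + 1)]
    linear_combination (1 - b * q ^ (N + 2)) * ih

/-- Andrews and Garvan's generating function of the crank, for a nilpotent `q`: `S m` is the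
contribution of the partitions with `m` ones, and `U m` that of the partitions with no ones and
with parts at most `m`. -/
theorem crank_generating_function {q z w : A} {K : ℕ} (hq : q ^ (K + 2) = 0) (h : z * w = 1)
    (S U : ℕ → A)
    (hS : ∀ m, S (m + 1) * ∏ i ∈ range (K + 2),
      (1 - (if i + 2 ≤ m + 1 then 1 else z) * q ^ (i + 2)) = (w * q) ^ (m + 1))
    (hU : ∀ m, U (m + 1) * ∏ i ∈ range (K + 2),
      (1 - (if i + 2 ≤ m + 1 then 1 else 0) * q ^ (i + 2)) = 1) :
    (∑ m ∈ range (K + 1), S (m + 1) +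
        ∑ k ∈ range K, z ^ (k + 2) * (U (k + 2) - U (k + 1)) + U 1 - q + z * q) *
      (qProd q z (K + 2) * qProd q w (K + 2)) = qProd q 1 (K + 2) := by
  have hnil : IsNilpotent q := ⟨_, hq⟩
  have hS' {m : ℕ} (hm : m < K + 1) : S (m + 1) * qProd q z (K + 2) =
      (1 - q) * (qBinomialCoeff q (z * q) (m + 1) * (w * q) ^ (m + 1)) := by
    have h1 := one_sub_mul_prod_ite_mul_qProd q 1 z (show 1 ≤ m + 1 by omega)
      (show m + 1 ≤ K + 2 + 1 by omega)
    rw [qProd_eq_of_le hq z (show K + 2 ≤ K + 2 + 1 by omega), one_mul] at h1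
    have h2 := qProd_one_mul_qBinomialCoeff hnil z (m + 1)
    refine (isUnit_qProd hnil 1 (m + 1)).mul_right_cancel ?_
    linear_combination (-S (m + 1)) * h1 + (1 - q) * qProd q z (m + 1) * hS m -
      (1 - q) * (w * q) ^ (m + 1) * h2
  have hU' {m : ℕ} (hm : m < K + 2) : U (m + 1) = (1 - q) * qBinomialCoeff q 0 (m + 1) := by
    have h1 := one_sub_mul_prod_ite_mul_qProd q 1 0 (show 1 ≤ m + 1 by omega)
      (show m + 1 ≤ K + 2 + 1 by omega)
    have h0 (N : ℕ) : qProd q 0 N = 1 := by simp [qProd]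
    have h2 := qProd_one_mul_qBinomialCoeff hnil 0 (m + 1)
    rw [h0, h0, one_mul] at h1
    rw [h0, zero_mul] at h2
    refine (isUnit_qProd hnil 1 (m + 1)).mul_right_cancel ?_
    linear_combination (-U (m + 1)) * h1 + (1 - q) * hU m - (1 - q) * h2
  have hq1 : (1 - q) * qBinomialCoeff q 0 1 = 1 := by
    have := one_sub_pow_mul_qBinomialCoeff_succ hnil 0 0
    simpa [qBinomialCoeff] using this
  have hUdiff {k : ℕ} (hk : k < K) : z ^ (k + 2) * (U (k + 2) - U (k + 1)) =
      (1 - q) * (qBinomialCoeff q 0 (k + 2) * (z * q) ^ (k + 2)) := by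
    rw [hU' (show k + 1 < K + 2 by omega), hU' (show k < K + 2 by omega)]
    have := one_sub_pow_mul_qBinomialCoeff_succ hnil 0 (k + 1)
    linear_combination z ^ (k + 2) * (1 - q) * this
  have hB1 := qBinomial_theorem (show 0 < K + 2 by omega) hq (z * q) w
  have hB2 := qBinomial_theorem (show 0 < K + 2 by omega) hq 0 z
  have hprod : (1 - q) * qProd q (z * q * w) (K + 2) = qProd q 1 (K + 2) := by
    rw [← qProd_eq_of_le hq 1 (show K + 2 ≤ K + 2 + 1 by omega), 
      show z * q * w = q by linear_combination q * h, qProd, qProd, prod_range_succ' _ (K + 2),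
      mul_comm]
    simp [pow_succ']
  rw [sum_range_succ'] at hB1
  rw [sum_range_succ', sum_range_succ'] at hB2
  have e1 : (∑ m ∈ range (K + 1), S (m + 1)) * qProd q z (K + 2) =
      (1 - q) * ∑ m ∈ range (K + 1), qBinomialCoeff q (z * q) (m + 1) * (w * q) ^ (m + 1) := by
    rw [sum_mul, mul_sum]
    exact sum_congr rfl fun m hm => hS' (mem_range.1 hm)
  have e2 : ∑ k ∈ range K, z ^ (k + 2) * (U (k + 2) - U (k + 1)) =
      (1 - q) * ∑ k ∈ range K, qBinomialCoeff q 0 (k + 2) * (z * q) ^ (k + 2) := by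
    rw [mul_sum]
    exact sum_congr rfl fun k hk => hUdiff (mem_range.1 hk)
  have e3 : U 1 = 1 := (hU' (show 0 < K + 2 by omega)).trans hq1
  have h00 : qProd q 0 (K + 2) = 1 := by simp [qProd]
  have hc (a : A) : qBinomialCoeff q a 0 = 1 := rfl
  simp only [add_assoc, Nat.reduceAdd, zero_add, zero_mul, h00, hc, pow_zero, pow_one, mul_one]
    at hB1 hB2 e1 e2 ⊢
  rw [e2, e3]
  linear_combination qProd q w (K + 2) * e1 + (1 - q) * hB1 + hprod +
    (1 - q) * qProd q w (K + 2) * hB2 -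
    z * q * qProd q z (K + 2) * qProd q w (K + 2) * hq1

end CrankSeries

section PartitionSeries

open scoped PowerSeries.WithPiTopology

/-- The character on partitions that weighs a part `i ≠ 1` by `y i`, the occurrence of exactly `m`
ones by `b`, and any other positive number of ones by `0`. -/
def onesCharacter {R : Type*} [CommRing R] (y : ℕ → R) (b : R) (m i c : ℕ) : R :=
  if i = 1 then if c = m then b else 0 else y i ^ c

lemma map_genFun_onesCharacter {R A : Type*} [CommRing R] [CommRing A] (φ : R⟦X⟧ →+* A) {M : ℕ}
    (hφ : φ X ^ M = 0) (hker : ∀ f, X ^ M ∣ f → φ f = 0) (y : ℕ → R) (b : R) {m : ℕ}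
    (hm : m ≠ 0) :
    φ (Nat.Partition.genFun (onesCharacter y b m)) *
      ∏ i ∈ range M, (1 - φ (C (y (i + 2))) * φ X ^ (i + 2)) = 1 + φ (C b) * φ X ^ m := by
  let : TopologicalSpace R := ⊥
  have : DiscreteTopology R := ⟨rfl⟩
  have hprod := Nat.Partition.hasProd_genFun (onesCharacter y b m)
  set F : ℕ → R⟦X⟧ := fun i =>
    1 + ∑' j, onesCharacter y b m (i + 1) (j + 1) • X ^ ((i + 1) * (j + 1)) with hF
  have hF0 : F 0 = 1 + C b * X ^ m := by
    simp only [hF]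
    rw [tsum_eq_single (m - 1)]
    · simp [onesCharacter, Nat.sub_add_cancel (Nat.pos_of_ne_zero hm), smul_eq_C_mul]
    · intro j hj
      simp [onesCharacter, show j + 1 ≠ m by omega]
  have hFs (i : ℕ) : F (i + 1) * (1 - C (y (i + 2)) * X ^ (i + 2)) = 1 := by
    have hu : constantCoeff (C (y (i + 2)) * X ^ (i + 2) : R⟦X⟧) = 0 := by simp
    have hsum := WithPiTopology.summable_pow_of_constantCoeff_eq_zero hu
    have hFi : F (i + 1) = ∑' j, (C (y (i + 2)) * X ^ (i + 2) : R⟦X⟧) ^ j := by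
      rw [hsum.tsum_eq_zero_add]
      simp [hF, onesCharacter, smul_eq_C_mul, mul_pow, ← pow_mul]
    rw [hFi, WithPiTopology.tsum_pow_mul_one_sub_of_constantCoeff_eq_zero hu]
  have hev : ∀ᶠ s : Finset ℕ in Filter.atTop, ∀ d ∈ range M,
      coeff d (∏ i ∈ s, F i) = coeff d (Nat.Partition.genFun (onesCharacter y b m)) := by
    rw [Filter.eventually_all_finset]
    intro d _
    have := (WithPiTopology.tendsto_iff_coeff_tendsto _ _ _ _).1 hprod d
    rwa [nhds_discrete, Filter.tendsto_pure] at this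
  obtain ⟨s, hs, hsM⟩ := (hev.and (Filter.eventually_ge_atTop (range (M + 1)))).exists
  have hgen : φ (Nat.Partition.genFun (onesCharacter y b m)) = ∏ i ∈ s, φ (F i) := by
    rw [← map_prod, ← sub_eq_zero, ← map_sub]
    refine hker _ (X_pow_dvd_iff.2 fun d hd => ?_)
    rw [map_sub, hs d (mem_range.2 hd), sub_self]
  have hφF (i : ℕ) : φ (F (i + 1)) * (1 - φ (C (y (i + 2))) * φ X ^ (i + 2)) = 1 := by
    simpa using congrArg φ (hFs i)
  rw [hgen, ← prod_subset hsM, prod_range_succ', mul_right_comm, ← prod_mul_distrib,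
    prod_congr rfl fun i _ => hφF i, hF0]
  · simp
  · intro i _ hi
    obtain ⟨j, rfl⟩ := Nat.exists_eq_add_of_le (show M + 1 ≤ i by simpa using hi)
    have := hφF (M + j)
    rw [pow_eq_zero_of_le (show M ≤ M + j + 2 by omega) hφ] at this
    simpa [add_right_comm] using this

lemma prod_onesCharacter {R : Type*} [CommRing R] {n : ℕ} (p : n.Partition) (y : ℕ → R)
    (hy : y 1 = 1) (b : R) (m : ℕ) :
    p.parts.toFinsupp.prod (onesCharacter y b m) = (p.parts.map y).prod *
      if p.parts.count 1 = 0 then 1 else if p.parts.count 1 = m then b else 0 := by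
  have key (i c : ℕ) : onesCharacter y b m i c =
      y i ^ c * if i = 1 then if c = m then b else 0 else 1 := by
    by_cases hi : i = 1 <;> simp [onesCharacter, hi, hy]
  rw [Finset.prod_multiset_map_count, Finsupp.prod, Multiset.toFinsupp_support,
    prod_congr rfl fun i _ => key i _, prod_mul_distrib]
  congr 1
  by_cases h : 1 ∈ p.parts
  · simp only [prod_ite_eq', Multiset.mem_toFinset, h, if_true, Multiset.count_eq_zero,
      not_true_eq_false, if_false]
    congr!
  · simp [h, prod_ite_eq']

lemma prod_map_ite_le {R : Type*} [CommRing R] (s : Multiset ℕ) (m : ℕ) (z : R) :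
    (s.map fun i => if i ≤ m then 1 else z).prod =
      z ^ Multiset.card (s.filter fun x => m < x) := by
  induction s using Multiset.induction_on with
  | empty => simp
  | cons a s ih =>
    by_cases h : a ≤ m
    · simp [h, ih]
    · simp [h, ih, pow_succ', not_le.1 h]

end PartitionSeries

section CrankCount

lemma Nat.Partition.count_one_le {n : ℕ} (p : n.Partition) : p.parts.count 1 ≤ n := by
  have h := Multiset.card_nsmul_le_sum (s := p.parts) (a := 1) fun i hi => p.parts_pos hi
  rw [p.parts_sum, smul_eq_mul, mul_one] at h
  exact (Multiset.count_le_card _ _).trans h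

lemma Nat.Partition.sup_parts_le {n : ℕ} (p : n.Partition) : p.parts.sup ≤ n :=
  Multiset.sup_le.2 fun _ hi => p.le_of_mem_parts hi

lemma Nat.Partition.sup_parts_ne_one {n : ℕ} (p : n.Partition) (h : p.parts.count 1 = 0) :
    p.parts.sup ≠ 1 := by
  intro hs
  have hall : ∀ i ∈ p.parts, i = 1 := fun i hi =>
    le_antisymm (hs ▸ Multiset.le_sup hi) (p.parts_pos hi)
  rcases p.parts.empty_or_exists_mem with h0 | ⟨i, hi⟩
  · simp [h0] at hs
  · rw [Multiset.count_eq_zero] at h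
    exact h (hall i hi ▸ hi)

lemma zero_pow_card_filter_lt {R : Type*} [CommRing R] (s : Multiset ℕ) (m : ℕ) :
    (0 : R) ^ Multiset.card (s.filter fun x => m < x) = if s.sup ≤ m then 1 else 0 := by
  have : Multiset.card (s.filter fun x => m < x) = 0 ↔ s.sup ≤ m := by
    rw [Multiset.card_eq_zero, Multiset.filter_eq_nil, Multiset.sup_le]
    simp
  rw [zero_pow_eq]
  simp [this]

/-- The weight `z ^ crank` as a combination of multiplicative characters of the partition. -/
lemma zpow_partitionCrank {F : Type*} [Field F] {z w : F} (hz : z * w = 1) {n K : ℕ}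
    (hn : n < K + 2) (p : n.Partition) :
    z ^ partitionCrank p =
      ∑ m ∈ range (K + 1),
        (p.parts.toFinsupp.prod (onesCharacter (fun i => if i ≤ m + 1 then 1 else z)
            (w ^ (m + 1)) (m + 1)) -
          p.parts.toFinsupp.prod (onesCharacter (fun i => if i ≤ m + 1 then 1 else z) 0 (m + 1))) +
      ∑ k ∈ range K, z ^ (k + 2) *
        (p.parts.toFinsupp.prod (onesCharacter (fun i => if i ≤ k + 2 then 1 else 0) 0 1) -
          p.parts.toFinsupp.prod (onesCharacter (fun i => if i ≤ k + 1 then 1 else 0) 0 1)) +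
      p.parts.toFinsupp.prod (onesCharacter (fun i => if i ≤ 1 then 1 else 0) 0 1) := by
  have hz0 : z ≠ 0 := left_ne_zero_of_mul_eq_one hz
  have hP (a b : F) (m l : ℕ) :
      p.parts.toFinsupp.prod (onesCharacter (fun i => if i ≤ m + 1 then 1 else a) b l) =
        a ^ Multiset.card (p.parts.filter fun x => m + 1 < x) *
          if p.parts.count 1 = 0 then 1 else if p.parts.count 1 = l then b else 0 := by
    rw [prod_onesCharacter _ _ (by simp), prod_map_ite_le]
  have hQ := hP 0 0 0 1
  simp only [zero_add] at hQ
  simp only [hQ, hP _ _ (_ + 1), hP, zero_pow_card_filter_lt]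
  by_cases h : p.parts.count 1 = 0
  · simp only [partitionCrank, h, if_true, sub_self, sum_const_zero, zero_add, mul_one,
      zpow_natCast]
    have h1 := p.sup_parts_ne_one h
    have hle := p.sup_parts_le
    generalize p.parts.sup = s at *
    rcases s with _ | _ | s
    · simp
    · simp at h1
    · rw [sum_eq_single s]
      · simp
      · intro k _ hk
        rcases lt_or_gt_of_ne hk with hk | hk
        · rw [if_neg (by omega), if_neg (by omega)]; simp
        · rw [if_pos (by omega), if_pos (by omega)]; simp
      · intro hs
        simp at hs
        omega
  · have hle := p.count_one_le
    simp only [partitionCrank, h, if_false, ite_self, mul_zero, sub_zero, sum_const_zero, add_zero]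
    obtain ⟨c, hc⟩ := Nat.exists_eq_add_one_of_ne_zero h
    rw [hc, sum_eq_single c]
    · rw [if_pos rfl, zpow_sub₀ hz0, zpow_natCast, zpow_natCast, eq_inv_of_mul_eq_one_right hz,
        inv_pow, div_eq_mul_inv]
    · intro m _ hm
      rw [if_neg (by omega), mul_zero]
    · intro hs
      simp at hs
      omega

/-- If `F * G` has no coefficients at indices `≡ r` modulo `t` below `M`, and `G` is a series in
`X ^ t` with constant coefficient `1`, then `F` has no such coefficients either. -/
lemma coeff_eq_zero_of_coeff_mul_eq_zero {R : Type*} [CommRing R] {F G : R⟦X⟧} {t r M : ℕ}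
    (hr : r < t)
    (hG : ∀ d, ¬ t ∣ d → coeff d G = 0) (hG0 : coeff 0 G = 1)
    (hFG : ∀ n, t * n + r < M → coeff (t * n + r) (F * G) = 0) (n : ℕ) (hn : t * n + r < M) :
    coeff (t * n + r) F = 0 := by
  induction n using Nat.strong_induction_on with
  | _ n ih =>
    have h := hFG n hn
    rw [coeff_mul, sum_eq_single (t * n + r, 0)] at h
    · simpa [hG0] using h
    · rintro ⟨a, b⟩ hab hne
      rw [HasAntidiagonal.mem_antidiagonal] at hab
      simp only at hab ⊢
      by_cases hb : t ∣ b
      · obtain ⟨k, rfl⟩ := hb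
        have hk : k ≠ 0 := by
          rintro rfl
          exact hne (by simpa using hab)
        have hkn : k ≤ n := by
          have : t * k < t * (n + 1) := by rw [mul_add]; omega
          exact Nat.lt_succ_iff.1 (Nat.lt_of_mul_lt_mul_left this)
        have ha : a = t * (n - k) + r := by
          rw [Nat.mul_sub]
          have := Nat.mul_le_mul_left t hkn
          omega
        rw [ha, ih (n - k) (by omega) (by omega), zero_mul]
      · rw [hG b hb, mul_zero]
    · simp

end CrankCount

section ModSeven

/-- The series `∑_{j < M} (-1) ^ j (w ^ j - z ^ (j + 1)) X ^ (j (j + 1) / 2)`. -/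
noncomputable def thetaSeries {R : Type*} [CommRing R] (z w : R) (M : ℕ) : R⟦X⟧ :=
  ∑ j ∈ range M, (-1) ^ j * X ^ (∑ i ∈ range (j + 1), i) * (C w ^ j - C z ^ (j + 1))

lemma sum_range_succ_id_mod_seven {j : ℕ} (hj : j % 7 ≠ 3) :
    (∑ i ∈ range (j + 1), i) % 7 = 0 ∨ (∑ i ∈ range (j + 1), i) % 7 = 1 ∨
      (∑ i ∈ range (j + 1), i) % 7 = 3 := by
  have h := sum_range_id_mul_two (j + 1)
  rw [Nat.add_sub_cancel] at h
  have h2 : (∑ i ∈ range (j + 1), i) * 2 % 7 = (j % 7 + 1) % 7 * (j % 7) % 7 := by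
    rw [h, Nat.mul_mod, Nat.mod_add_mod]
  have hlt := Nat.mod_lt j (show 7 > 0 by norm_num)
  generalize j % 7 = r at *
  interval_cases r <;> omega

lemma coeff_thetaSeries_eq_zero {R : Type*} [CommRing R] {z w : R} (h : z * w = 1)
    (h7 : z ^ 7 = 1) (M : ℕ) {d : ℕ} (h0 : d % 7 ≠ 0) (h1 : d % 7 ≠ 1) (h3 : d % 7 ≠ 3) :
    coeff d (thetaSeries z w M) = 0 := by
  rw [thetaSeries, map_sum]
  refine sum_eq_zero fun j _ => ?_
  by_cases hj : j % 7 = 3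
  · have hwz : w ^ j = z ^ (j + 1) := by
      obtain ⟨k, rfl⟩ : ∃ k, j = 7 * k + 3 := ⟨j / 7, by omega⟩
      have hw7 : w ^ 7 = 1 := by
        have := congrArg (· ^ 7) h
        simpa [mul_pow, h7] using this
      have hw3 : w ^ 3 = z ^ 4 := by
        calc w ^ 3 = z ^ 7 * w ^ 3 := by rw [h7, one_mul]
          _ = z ^ 4 * (z * w) ^ 3 := by ring
          _ = z ^ 4 := by rw [h]; ring
      rw [show 7 * k + 3 + 1 = 7 * k + 4 by ring, pow_add, pow_add, pow_mul, pow_mul, hw7, h7,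
        hw3, one_pow]
    rw [← map_pow, ← map_pow, hwz, sub_self, mul_zero, map_zero]
  · have hT := sum_range_succ_id_mod_seven hj
    have hd : d ≠ ∑ i ∈ range (j + 1), i := by rintro rfl; omega
    rw [show ((-1) ^ j * X ^ (∑ i ∈ range (j + 1), i) * (C w ^ j - C z ^ (j + 1)) : R⟦X⟧) =
      C ((-1) ^ j * (w ^ j - z ^ (j + 1))) * X ^ (∑ i ∈ range (j + 1), i) by simp; ring,
      coeff_C_mul, coeff_X_pow, if_neg hd, mul_zero]

lemma coeff_thetaSeries_mul_thetaSeries_eq_zero {R : Type*} [CommRing R] {z w z' w' : R}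
    (h : z * w = 1) (h' : z' * w' = 1) (h7 : z ^ 7 = 1) (h7' : z' ^ 7 = 1) (M n : ℕ) :
    coeff (7 * n + 5) (thetaSeries z w M * thetaSeries z' w' M) = 0 := by
  rw [coeff_mul]
  refine sum_eq_zero fun ⟨a, b⟩ hab => ?_
  rw [HasAntidiagonal.mem_antidiagonal] at hab
  simp only at hab ⊢
  by_cases ha : a % 7 = 0 ∨ a % 7 = 1 ∨ a % 7 = 3
  · rw [coeff_thetaSeries_eq_zero h' h7' M (by omega) (by omega) (by omega), mul_zero]
  · push Not at ha
    rw [coeff_thetaSeries_eq_zero h h7 M ha.1 ha.2.1 ha.2.2, zero_mul]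

lemma coeff_prod_one_sub_X_pow_mul_eq_zero (R : Type*) [CommRing R] (t M : ℕ) {d : ℕ}
    (hd : ¬ t ∣ d) : coeff d (∏ i ∈ range M, (1 - (X ^ (i + 1)) ^ t : R⟦X⟧)) = 0 := by
  induction M generalizing d with
  | zero =>
    have : d ≠ 0 := by rintro rfl; simp at hd
    simp [coeff_one, this]
  | succ M ih =>
    rw [prod_range_succ, coeff_mul]
    refine sum_eq_zero fun ⟨a, b⟩ hab => ?_
    rw [HasAntidiagonal.mem_antidiagonal] at hab
    simp only at hab ⊢
    by_cases ha : t ∣ a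
    · have hb : ¬ t ∣ b := fun hb => hd (hab ▸ dvd_add ha hb)
      have hb0 : b ≠ 0 := by rintro rfl; simp at hb
      have hbt : b ≠ (M + 1) * t := by rintro rfl; simp at hb
      simp [← pow_mul, coeff_one, coeff_X_pow, hb0, hbt]
    · rw [ih ha, zero_mul]

/-- The generating function of the weights `z ^ crank`. -/
noncomputable def crankSeries {F : Type*} [Field F] (z : F) : F⟦X⟧ :=
  PowerSeries.mk fun n => ∑ p : n.Partition, z ^ partitionCrank p

lemma map_crankSeries {F A : Type*} [Field F] [CommRing A] (φ : F⟦X⟧ →+* A) {K : ℕ}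
    (hker : ∀ f, X ^ (K + 2) ∣ f → φ f = 0) {z w : F} (h : z * w = 1) :
    (φ (crankSeries z) - φ X + φ (C z) * φ X) *
      (qProd (φ X) (φ (C z)) (K + 2) * qProd (φ X) (φ (C w)) (K + 2)) =
        qProd (φ X) 1 (K + 2) := by
  have hφ : φ X ^ (K + 2) = 0 := by rw [← map_pow]; exact hker _ dvd_rfl
  let G (m : ℕ) (a b : F) (l : ℕ) : F⟦X⟧ :=
    Nat.Partition.genFun (onesCharacter (fun i => if i ≤ m then 1 else a) b l)
  have hG (m : ℕ) (a b : F) {l : ℕ} (hl : l ≠ 0) : φ (G m a b l) *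
      ∏ i ∈ range (K + 2), (1 - (if i + 2 ≤ m then 1 else φ (C a)) * φ X ^ (i + 2)) =
        1 + φ (C b) * φ X ^ l := by
    rw [← map_genFun_onesCharacter φ hφ hker (fun i => if i ≤ m then 1 else a) b hl]
    congr 1
    refine prod_congr rfl fun i _ => ?_
    split_ifs <;> simp
  have hsum : φ (crankSeries z) =
      ∑ m ∈ range (K + 1), φ (G (m + 1) z (w ^ (m + 1)) (m + 1) - G (m + 1) z 0 (m + 1)) +
      ∑ k ∈ range K, φ (C z) ^ (k + 2) * (φ (G (k + 2) 0 0 1) - φ (G (k + 1) 0 0 1)) +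
      φ (G 1 0 0 1) := by
    simp only [← map_pow, ← map_sub, ← map_mul, ← map_sum, ← map_add]
    rw [← sub_eq_zero, ← map_sub]
    refine hker _ (X_pow_dvd_iff.2 fun n hn => ?_)
    rw [map_sub, sub_eq_zero, crankSeries, coeff_mk,
      sum_congr rfl fun p _ => zpow_partitionCrank h hn p]
    simp only [G, map_add, map_sum, map_sub, coeff_C_mul, Nat.Partition.coeff_genFun,
      sum_add_distrib, ← sum_sub_distrib, mul_sum]
    congr 2 <;> exact sum_comm
  rw [hsum]
  refine crank_generating_function hφ (by rw [← map_mul, ← map_mul, h, map_one, map_one])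
    (fun m => φ (G m z (w ^ m) m - G m z 0 m)) (fun m => φ (G m 0 0 1)) (fun m => ?_) fun m => ?_
  · have h1 := hG (m + 1) z (w ^ (m + 1)) m.add_one_ne_zero
    have h2 := hG (m + 1) z 0 m.add_one_ne_zero
    rw [map_sub, sub_mul, h1, h2, mul_pow, map_pow, map_pow, map_zero, map_zero]
    ring
  · simpa using hG (m + 1) 0 0 one_ne_zero

/-- The weighted crank count vanishes at a primitive seventh root of unity. -/
theorem sum_zpow_partitionCrank_eq_zero {F : Type*} [Field F] {z : F} (h : IsPrimitiveRoot z 7)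
    (n : ℕ) : ∑ p : (7 * n + 5).Partition, z ^ partitionCrank p = 0 := by
  set K := 7 * n + 4
  let φ := Ideal.Quotient.mk (Ideal.span {(X : F⟦X⟧) ^ (K + 2)})
  have hφ0 (f : F⟦X⟧) : φ f = 0 ↔ X ^ (K + 2) ∣ f := by
    rw [Ideal.Quotient.eq_zero_iff_mem, Ideal.mem_span_singleton]
  have hq : φ X ^ (K + 2) = 0 := by rw [← map_pow]; exact (hφ0 _).2 dvd_rfl
  have h7 : z ^ 7 = 1 := h.pow_eq_one
  have hgeom : 1 + z + z ^ 2 + z ^ 3 + z ^ 4 + z ^ 5 + z ^ 6 = 0 := by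
    simpa [sum_range_succ] using h.geom_sum_eq_zero (by norm_num)
  have hne : (1 - z ^ 2) * (1 - z ^ 3) ≠ 0 :=
    mul_ne_zero (sub_ne_zero.2 (h.pow_ne_one_of_pos_of_lt (by norm_num) (by norm_num)).symm)
      (sub_ne_zero.2 (h.pow_ne_one_of_pos_of_lt (by norm_num) (by norm_num)).symm)
  have hcrank := map_crankSeries φ (fun f hf => (hφ0 f).2 hf)
    (show z * z ^ 6 = 1 by rw [← pow_succ', h7])
  have hinv (a b : ℕ) (hab : a + b = 7) : z ^ a * z ^ b = 1 := by rw [← pow_add, hab, h7]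
  have hpow (a : ℕ) : (z ^ a) ^ 7 = 1 := by rw [← pow_mul, mul_comm, pow_mul, h7, one_pow]
  have htheta (a b : ℕ) (hab : a + b = 7) :
      (1 - φ (C (z ^ a))) * (qProd (φ X) 1 (K + 2) * qProd (φ X) (φ (C (z ^ a))) (K + 2) *
        qProd (φ X) (φ (C (z ^ b))) (K + 2)) = φ (thetaSeries (z ^ a) (z ^ b) (K + 2)) := by
    rw [jacobi_triple_product hq (by rw [← map_mul, ← map_mul, hinv a b hab, map_one, map_one])]
    simp [thetaSeries]
  have hall : qProd (φ X) 1 (K + 2) *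
      (qProd (φ X) (φ (C z)) (K + 2) * qProd (φ X) (φ (C (z ^ 6))) (K + 2)) *
      (qProd (φ X) (φ (C (z ^ 2))) (K + 2) * qProd (φ X) (φ (C (z ^ 5))) (K + 2)) *
      (qProd (φ X) (φ (C (z ^ 3))) (K + 2) * qProd (φ X) (φ (C (z ^ 4))) (K + 2)) =
      φ (∏ i ∈ range (K + 2), (1 - (X ^ (i + 1)) ^ 7)) := by
    simp only [qProd, ← prod_mul_distrib, map_prod]
    refine prod_congr rfl fun i _ => ?_
    have := one_sub_pow_seven_eq (z := φ (C z)) (by simp [← map_pow, h7])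
      (by simpa using congrArg (fun x => φ (C x)) hgeom) (φ X ^ (i + 1))
    simpa using this
  have hfinal : φ ((crankSeries z - X + C z * X) * C ((1 - z ^ 2) * (1 - z ^ 3)) *
      ∏ i ∈ range (K + 2), (1 - (X ^ (i + 1)) ^ 7)) =
      φ (thetaSeries (z ^ 2) (z ^ 5) (K + 2) * thetaSeries (z ^ 3) (z ^ 4) (K + 2)) := by
    rw [map_mul, ← hall, map_mul φ (thetaSeries _ _ _), ← htheta 2 5 rfl, ← htheta 3 4 rfl]
    simp only [map_mul, map_sub, map_add, map_one]
    linear_combination qProd (φ X) 1 (K + 2) *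
      (qProd (φ X) (φ (C (z ^ 2))) (K + 2) * qProd (φ X) (φ (C (z ^ 5))) (K + 2)) *
      (qProd (φ X) (φ (C (z ^ 3))) (K + 2) * qProd (φ X) (φ (C (z ^ 4))) (K + 2)) *
      (1 - φ (C (z ^ 2))) * (1 - φ (C (z ^ 3))) * hcrank
  rw [← sub_eq_zero, ← map_sub, hφ0, X_pow_dvd_iff] at hfinal
  have hprod (m : ℕ) (hm : 7 * m + 5 < K + 2) :
      coeff (7 * m + 5) ((crankSeries z - X + C z * X) * C ((1 - z ^ 2) * (1 - z ^ 3)) *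
        ∏ i ∈ range (K + 2), (1 - (X ^ (i + 1)) ^ 7)) = 0 := by
    have := hfinal _ hm
    rwa [map_sub, coeff_thetaSeries_mul_thetaSeries_eq_zero (hinv 2 5 rfl) (hinv 3 4 rfl)
      (hpow 2) (hpow 3), sub_zero] at this
  have hzero := coeff_eq_zero_of_coeff_mul_eq_zero (M := K + 2) (show 5 < 7 by norm_num)
    (fun d hd => coeff_prod_one_sub_X_pow_mul_eq_zero F 7 (K + 2) hd)
    (by simp [map_prod, ← pow_mul]) hprod n (show 7 * n + 5 < K + 2 by omega)
  rw [coeff_mul_C] at hzero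
  simpa [crankSeries, coeff_X, coeff_C_mul] using (mul_eq_zero.1 hzero).resolve_right hne

/-- Rational coefficients of a vanishing combination of all `p`-th roots of unity agree. -/
lemma eq_of_sum_mul_pow_eq_zero {F : Type*} [Field F] [CharZero F] {p : ℕ} (hp : p.Prime) {z : F}
    (h : IsPrimitiveRoot z p) (c : ℕ → ℚ) (hc : ∑ i ∈ range p, (c i : F) * z ^ i = 0)
    {i : ℕ} (hi : i < p) : c i = c (p - 1) := by
  have : Fact p.Prime := ⟨hp⟩
  have hp1 : p - 1 + 1 = p := Nat.sub_add_cancel hp.one_le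
  let P : Polynomial ℚ :=
    ∑ i ∈ range (p - 1), Polynomial.C (c i - c (p - 1)) * Polynomial.X ^ i
  have hroot : Polynomial.aeval z P = 0 := by
    have hg := h.geom_sum_eq_zero hp.one_lt
    have h1 : ∑ i ∈ range p, ((c i - c (p - 1) : ℚ) : F) * z ^ i = 0 := by
      simp only [Rat.cast_sub, sub_mul, sum_sub_distrib, hc, ← mul_sum, hg, mul_zero, sub_zero]
    rw [← hp1, sum_range_succ] at h1
    simpa [P] using h1
  have hdvd := minpoly.dvd ℚ z hroot
  rw [← Polynomial.cyclotomic_eq_minpoly_rat h hp.pos] at hdvd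
  have hP : P = 0 := by
    refine Polynomial.eq_zero_of_dvd_of_degree_lt hdvd ?_
    rw [Polynomial.degree_cyclotomic, Nat.totient_prime hp, Polynomial.degree_lt_iff_coeff_zero]
    intro m hm
    simp only [P, Polynomial.finsetSum_coeff, Polynomial.coeff_C_mul_X_pow, sum_ite_eq, mem_range]
    exact if_neg hm.not_gt
  by_cases hip : i = p - 1
  · rw [hip]
  · have := congrArg (fun Q => Polynomial.coeff Q i) hP
    simp only [P, Polynomial.finsetSum_coeff, Polynomial.coeff_C_mul_X_pow, sum_ite_eq, mem_range,
      Polynomial.coeff_zero] at this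
    rw [if_pos (by omega)] at this
    exact sub_eq_zero.1 this

end ModSeven

/-- **Andrews–Garvan mod 7**: for every `n ≥ 0` and every `0 ≤ k ≤ 6`, the number of
partitions of `7n + 5` with crank congruent to `k` modulo `7` equals `p(7n+5) / 7`. -/
theorem crank_equidistribution_mod_seven (n : ℕ) (k : ℤ) (hk0 : 0 ≤ k) (hk6 : k ≤ 6) :
    ((Finset.univ.filter
        (fun p : Nat.Partition (7 * n + 5) => partitionCrank p % 7 = k)).card : ℚ) =
      (Fintype.card (Nat.Partition (7 * n + 5)) : ℚ) / 7 := by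
  have hz := Complex.isPrimitiveRoot_exp 7 (by norm_num)
  set z := Complex.exp (2 * Real.pi * Complex.I / (7 : ℕ))
  let N (i : ℕ) : ℚ := ((Finset.univ.filter
    (fun p : Nat.Partition (7 * n + 5) => partitionCrank p % 7 = i)).card : ℚ)
  have hmod (p : Nat.Partition (7 * n + 5)) :
      ∃ i ∈ range 7, partitionCrank p % 7 = (i : ℤ) :=
    ⟨(partitionCrank p % 7).toNat, by rw [mem_range]; omega, by omega⟩
  have hmod' (p : Nat.Partition (7 * n + 5)) :
      z ^ partitionCrank p =
        ∑ i ∈ range 7, if partitionCrank p % 7 = (i : ℤ) then z ^ i else 0 := by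
    obtain ⟨i, hi, hpi⟩ := hmod p
    rw [sum_eq_single_of_mem i hi, if_pos hpi, ← zpow_natCast z i, ← hpi]
    · conv_lhs => rw [← Int.mul_ediv_add_emod (partitionCrank p) 7]
      rw [zpow_add₀ (hz.ne_zero (by norm_num)), zpow_mul]
      have : z ^ (7 : ℤ) = 1 := by exact_mod_cast hz.pow_eq_one
      rw [this, one_zpow, one_mul]
    · intro j _ hj
      exact if_neg fun h => hj (by omega)
  have hsum : ∑ i ∈ range 7, ((N i : ℚ) : ℂ) * z ^ i = 0 := by
    rw [← sum_zpow_partitionCrank_eq_zero hz n, sum_congr rfl fun p _ => hmod' p, sum_comm]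
    refine sum_congr rfl fun i _ => ?_
    rw [← sum_filter, sum_const, nsmul_eq_mul]
    simp [N]
  have hN (i : ℕ) (hi : i < 7) : N i = N 6 :=
    eq_of_sum_mul_pow_eq_zero (by norm_num) hz N hsum hi
  have htotal : (Fintype.card (Nat.Partition (7 * n + 5)) : ℚ) = ∑ i ∈ range 7, N i := by
    have h1 (p : Nat.Partition (7 * n + 5)) :
        (1 : ℚ) = ∑ i ∈ range 7, if partitionCrank p % 7 = (i : ℤ) then 1 else 0 := by
      obtain ⟨i, hi, hpi⟩ := hmod p
      rw [sum_eq_single_of_mem i hi, if_pos hpi]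
      exact fun j _ hj => if_neg fun h => hj (by omega)
    rw [← card_univ, card_eq_sum_ones, Nat.cast_sum, Nat.cast_one,
      sum_congr rfl fun p _ => h1 p, sum_comm]
    refine sum_congr rfl fun i _ => ?_
    simp [N]
  rw [sum_congr rfl fun i hi => hN i (mem_range.1 hi)] at htotal
  lift k to ℕ using hk0
  change N k = _
  rw [hN k (by omega), htotal]
  simp
end
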